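/- arXiv:math/0610242 — 2 statements merged into one kernel-verified Lean document; each statement's English description precedes it below -/
import Mathlib

section
/- Under hypotheses (H0)-(H4), for every q ∈ ℝ^{d−1}×(0,∞) the following hold: (1) there is a unique vector γ_q ∈ ℝ^{d−1}×{0} such that q−γ_q belongs to the normal cone to D at â(q) and both γ_q and q−γ_q belong to V(â(q)); (2) if γ_q ≠ 0, then φ₀(overline{â(q)}) = 1. -/
open scoped ENNReal
open Filter MeasureTheory

namespace ReflectedRW

/-- `ℤ^d` realized as `ℤ^{d-1} × ℤ`. -/
abbrev Zd (d : ℕ) := (Fin (d-1) → ℤ) × ℤ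
/-- `ℝ^d` realized as `ℝ^{d-1} × ℝ`. -/
abbrev Rd (d : ℕ) := (Fin (d-1) → ℝ) × ℝ
/-- The state space `ℤ^{d-1} × ℕ` of the reflected walk. -/
abbrev St (d : ℕ) := (Fin (d-1) → ℤ) × ℕ

/-- Embedding of the state space into `ℤ^d`. -/
def toZ (d : ℕ) (z : St d) : Zd d := (z.1, (z.2 : ℤ))

/-- Embedding of `ℤ^d` into `ℝ^d`. -/
def toR (d : ℕ) (z : Zd d) : Rd d := (fun i => (z.1 i : ℝ), (z.2 : ℝ))

/-- Scalar product `a · z` of `a ∈ ℝ^d` and `z ∈ ℤ^d`. -/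
noncomputable def dotZ (d : ℕ) (a : Rd d) (z : Zd d) : ℝ :=
  (∑ i, a.1 i * (z.1 i : ℝ)) + a.2 * (z.2 : ℝ)

/-- Scalar product on `ℝ^d`. -/
noncomputable def dotR (d : ℕ) (a q : Rd d) : ℝ :=
  (∑ i, a.1 i * q.1 i) + a.2 * q.2

/-- One-step transition probabilities of the reflected random walk `Z(t)`:
jumps with law `μ` in the interior and with law `μ0` on the boundary `y = 0`. -/
noncomputable def step (d : ℕ) (μ μ0 : Zd d → ℝ) (z z' : St d) : ℝ≥0∞ :=
  if z.2 = 0 then ENNReal.ofReal (μ0 (toZ d z' - toZ d z))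
  else ENNReal.ofReal (μ (toZ d z' - toZ d z))

/-- Real-valued version of the transition kernel of `Z(t)`. -/
noncomputable def stepR (d : ℕ) (μ μ0 : Zd d → ℝ) (z z' : St d) : ℝ :=
  if z.2 = 0 then μ0 (toZ d z' - toZ d z) else μ (toZ d z' - toZ d z)

/-- `n`-step kernel obtained by iterating a sub-Markov kernel `p`. -/
noncomputable def kerIter {S : Type*} [DecidableEq S] (p : S → S → ℝ≥0∞) :
    ℕ → S → S → ℝ≥0∞
  | 0, z, z' => if z = z' then 1 else 0
  | n+1, z, z' => ∑' w : S, kerIter p n z w * p w z'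

/-- `n`-step transition probabilities of `Z(t)`: `P_z(Z(n) = z')`. -/
noncomputable def stepn (d : ℕ) (μ μ0 : Zd d → ℝ) : ℕ → St d → St d → ℝ≥0∞ :=
  kerIter (step d μ μ0)

/-- Green's function `G(z,z') = ∑_{t ≥ 0} P_z(Z(t) = z')` of the reflected walk. -/
noncomputable def green (d : ℕ) (μ μ0 : Zd d → ℝ) (z z' : St d) : ℝ≥0∞ :=
  ∑' n : ℕ, stepn d μ μ0 n z z'

/-- Kernel of the walk killed upon hitting the boundary hyperplane `y = 0`. -/
noncomputable def stepKilled (d : ℕ) (μ μ0 : Zd d → ℝ) (z z' : St d) : ℝ≥0∞ :=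
  if z'.2 = 0 then 0 else step d μ μ0 z z'

/-- `n`-step kernel of the killed walk: `P_z(Z(n) = z', τ > n)` where
`τ` is the first return time to the boundary hyperplane. -/
noncomputable def stepKilledn (d : ℕ) (μ μ0 : Zd d → ℝ) : ℕ → St d → St d → ℝ≥0∞ :=
  kerIter (stepKilled d μ μ0)

/-- Green's function `G₊(z,z')` of the killed walk. -/
noncomputable def greenPlus (d : ℕ) (μ μ0 : Zd d → ℝ) (z z' : St d) : ℝ≥0∞ :=
  ∑' n : ℕ, stepKilledn d μ μ0 n z z'

/-- One-step kernel of the homogeneous random walk `S(t)` on `ℤ^d`. -/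
noncomputable def stepS (d : ℕ) (μ : Zd d → ℝ) (z z' : Zd d) : ℝ≥0∞ :=
  ENNReal.ofReal (μ (z' - z))

/-- `n`-step kernel of the homogeneous random walk on `ℤ^d`. -/
noncomputable def stepSn (d : ℕ) (μ : Zd d → ℝ) : ℕ → Zd d → Zd d → ℝ≥0∞ :=
  kerIter (stepS d μ)

/-- Green's function `G_S` of the homogeneous random walk on `ℤ^d`. -/
noncomputable def greenS (d : ℕ) (μ : Zd d → ℝ) (z z' : Zd d) : ℝ≥0∞ :=
  ∑' n : ℕ, stepSn d μ n z z'

/-- `hitProb z w = P_z(τ < ∞, Z(τ) = w)`, the hitting distribution on the boundary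
hyperplane, `τ = inf{t ≥ 1 : Z(t) ∈ ℤ^{d-1}×{0}}`. -/
noncomputable def hitProb (d : ℕ) (μ μ0 : Zd d → ℝ) (z w : St d) : ℝ≥0∞ :=
  if w.2 = 0 then
    ∑' n : ℕ, ∑' v : St d, stepKilledn d μ μ0 n z v * step d μ μ0 v w
  else 0

/-- The jump generating function `φ(a) = ∑_z μ(z) e^{a·z}`. -/
noncomputable def jgf (d : ℕ) (μ : Zd d → ℝ) (a : Rd d) : ℝ :=
  ∑' z : Zd d, μ z * Real.exp (dotZ d a z)

/-- Partial derivative `∂φ/∂β` of the jump generating function in the last coordinate. -/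
noncomputable def jgfDβ (d : ℕ) (μ : Zd d → ℝ) (a : Rd d) : ℝ :=
  ∑' z : Zd d, μ z * (z.2 : ℝ) * Real.exp (dotZ d a z)

/-- Gradient `∇φ(a)` of the jump generating function. -/
noncomputable def jgfGrad (d : ℕ) (μ : Zd d → ℝ) (a : Rd d) : Rd d :=
  (fun i => ∑' z : Zd d, μ z * (z.1 i : ℝ) * Real.exp (dotZ d a z), jgfDβ d μ a)

/-- The set `D = {a : φ(a) ≤ 1}`. -/
def Dset (d : ℕ) (μ : Zd d → ℝ) : Set (Rd d) := {a | jgf d μ a ≤ 1}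

/-- `∂₊D`: points of the boundary of `D` where the last coordinate of `∇φ` is `≥ 0`. -/
def bdPlus (d : ℕ) (μ : Zd d → ℝ) : Set (Rd d) :=
  {a | jgf d μ a = 1 ∧ 0 ≤ jgfDβ d μ a}

/-- `∂₋D`: points of the boundary of `D` where the last coordinate of `∇φ` is `≤ 0`. -/
def bdMinus (d : ℕ) (μ : Zd d → ℝ) : Set (Rd d) :=
  {a | jgf d μ a = 1 ∧ jgfDβ d μ a ≤ 0}

/-- `∂₀D`: points of the boundary of `D` where the last coordinate of `∇φ` is `0`. -/
def bdZero (d : ℕ) (μ : Zd d → ℝ) : Set (Rd d) :=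
  {a | jgf d μ a = 1 ∧ jgfDβ d μ a = 0}

/-- `Θ = {α ∈ ℝ^{d-1} : inf_β max(φ(α,β), φ₀(α,β)) ≤ 1}`. -/
noncomputable def Theta (d : ℕ) (μ μ0 : Zd d → ℝ) : Set (Fin (d-1) → ℝ) :=
  {α | (⨅ β : ℝ, max (jgf d μ (α, β)) (jgf d μ0 (α, β))) ≤ 1}

/-- `D̂ = (Θ×ℝ) ∩ D`. -/
noncomputable def Dhat (d : ℕ) (μ μ0 : Zd d → ℝ) : Set (Rd d) :=
  {a | a.1 ∈ Theta d μ μ0 ∧ jgf d μ a ≤ 1}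

/-- Normal cone to a convex set `s ⊆ ℝ^d` at the point `a`. -/
noncomputable def normalCone (d : ℕ) (s : Set (Rd d)) (a : Rd d) : Set (Rd d) :=
  {q | ∀ b ∈ s, dotR d q (b - a) ≤ 0}

/-- The mean vector `m = ∑_z z μ(z)`. -/
noncomputable def meanVec (d : ℕ) (μ : Zd d → ℝ) : Rd d :=
  (fun i => ∑' z : Zd d, μ z * (z.1 i : ℝ), ∑' z : Zd d, μ z * (z.2 : ℝ))

/-- The harmonic functions `h_a` of (1-8), for `a ∈ D̂ ∩ ∂₊D` with associated
point `abar = ā ∈ ∂₋D` (same first `d-1` coordinates as `a`). -/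
noncomputable def hfun (d : ℕ) (μ μ0 : Zd d → ℝ) (a abar : Rd d) (z : St d) : ℝ :=
  if jgf d μ0 abar = 1 then Real.exp (dotZ d abar (toZ d z))
  else if a = abar then
    (z.2 : ℝ) * Real.exp (dotZ d a (toZ d z))
      + (jgfDβ d μ0 a / (1 - jgf d μ0 a)) * Real.exp (dotZ d a (toZ d z))
  else
    Real.exp (dotZ d a (toZ d z))
      - ((1 - jgf d μ0 a) / (1 - jgf d μ0 abar)) * Real.exp (dotZ d abar (toZ d z))

/-- `h : ℤ^{d-1}×ℕ → ℝ` is harmonic for the reflected walk. -/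
def IsHarmonic (d : ℕ) (μ μ0 : Zd d → ℝ) (h : St d → ℝ) : Prop :=
  ∀ z : St d, HasSum (fun z' => stepR d μ μ0 z z' * h z') (h z)

/-- Minimal nonnegative harmonic function. -/
def IsMinimalHarmonic (d : ℕ) (μ μ0 : Zd d → ℝ) (h : St d → ℝ) : Prop :=
  IsHarmonic d μ μ0 h ∧ (∀ z, 0 ≤ h z) ∧ h ≠ 0 ∧
    ∀ h' : St d → ℝ, IsHarmonic d μ μ0 h' → (∀ z, 0 ≤ h' z) → h' ≠ 0 →
      (∀ z, h' z ≤ h z) → ∃ c : ℝ, 0 < c ∧ h' = fun z => c * h z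

/- Hypotheses (H0)–(H4). -/

/-- `(H0)`: `μ(x,y) = 0` for `y < -1` and `μ₀(x,y) = 0` for `y < 0`. -/
def H0 (d : ℕ) (μ μ0 : Zd d → ℝ) : Prop :=
  (∀ z : Zd d, z.2 < -1 → μ z = 0) ∧ (∀ z : Zd d, z.2 < 0 → μ0 z = 0)

/-- `(H1)`: the reflected walk is irreducible on `ℤ^{d-1}×ℕ`. -/
def H1 (d : ℕ) (μ μ0 : Zd d → ℝ) : Prop :=
  ∀ z z' : St d, ∃ n : ℕ, 0 < stepn d μ μ0 n z z'

/-- `(H2)`: the homogeneous walk with step law `μ` is irreducible on `ℤ^d` and its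
last coordinate is an aperiodic random walk on `ℤ`. -/
def H2 (d : ℕ) (μ : Zd d → ℝ) : Prop :=
  (∀ z z' : Zd d, ∃ n : ℕ, 0 < stepSn d μ n z z') ∧
    AddSubgroup.closure {y : ℤ | ∃ x : Fin (d-1) → ℤ, μ (x, y) ≠ 0} = ⊤

/-- `(H3)`: `m ≠ 0` and `m/|m| + m₀/|m₀| ≠ 0`. -/
noncomputable def H3 (d : ℕ) (μ μ0 : Zd d → ℝ) : Prop :=
  meanVec d μ ≠ 0 ∧ meanVec d μ0 ≠ 0 ∧
    ‖meanVec d μ‖⁻¹ • meanVec d μ + ‖meanVec d μ0‖⁻¹ • meanVec d μ0 ≠ 0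

/-- `(H4)`: the jump generating functions are finite everywhere on `ℝ^d`. -/
def H4 (d : ℕ) (μ μ0 : Zd d → ℝ) : Prop :=
  ∀ a : Rd d, Summable (fun z : Zd d => μ z * Real.exp (dotZ d a z)) ∧
    Summable (fun z : Zd d => μ0 z * Real.exp (dotZ d a z))

/-- `μ` is a probability distribution on `ℤ^d`. -/
def IsProb (d : ℕ) (μ : Zd d → ℝ) : Prop :=
  (∀ z : Zd d, 0 ≤ μ z) ∧ HasSum μ 1


theorem dotZ_add_smul (d : ℕ) (a u : Rd d) (t : ℝ) (z : Zd d) :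
    dotZ d (a + t • u) z = dotZ d a z + t * dotZ d u z := by
  simp only [dotZ, Prod.fst_add, Prod.snd_add, Prod.smul_fst, Prod.smul_snd, Pi.add_apply,
    Pi.smul_apply, smul_eq_mul, add_mul, Finset.sum_add_distrib, mul_add, Finset.mul_sum,
    mul_assoc]
  ring

theorem dotZ_zero (d : ℕ) (z : Zd d) : dotZ d 0 z = 0 := by
  simp [dotZ]

theorem dotR_add_smul_right (d : ℕ) (p a u : Rd d) (t : ℝ) :
    dotR d p (a + t • u) = dotR d p a + t * dotR d p u := by
  simp only [dotR, Prod.fst_add, Prod.snd_add, Prod.smul_fst, Prod.smul_snd, Pi.add_apply,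
    Pi.smul_apply, smul_eq_mul, Finset.sum_add_distrib, mul_add, Finset.mul_sum,
    mul_left_comm]
  ring

theorem dotR_comm (d : ℕ) (p u : Rd d) : dotR d p u = dotR d u p := by
  simp only [dotR, mul_comm]

theorem dotR_add_smul_left (d : ℕ) (p r u : Rd d) (t : ℝ) :
    dotR d (p + t • r) u = dotR d p u + t * dotR d r u := by
  rw [dotR_comm, dotR_add_smul_right, dotR_comm d u p, dotR_comm d u r]

theorem dotR_zero_right (d : ℕ) (p : Rd d) : dotR d p 0 = 0 := by
  simp [dotR]

theorem dotR_smul_right (d : ℕ) (p u : Rd d) (t : ℝ) :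
    dotR d p (t • u) = t * dotR d p u := by
  simpa [dotR_zero_right] using dotR_add_smul_right d p 0 u t

theorem dotR_smul_left (d : ℕ) (p u : Rd d) (t : ℝ) :
    dotR d (t • p) u = t * dotR d p u := by
  rw [dotR_comm, dotR_smul_right, dotR_comm]

theorem dotR_sub_left (d : ℕ) (p r u : Rd d) :
    dotR d (p - r) u = dotR d p u - dotR d r u := by
  have h := dotR_add_smul_left d p r u (-1)
  rw [neg_one_smul, ← sub_eq_add_neg] at h
  linarith

theorem dotR_self_nonneg (d : ℕ) (p : Rd d) : 0 ≤ dotR d p p :=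
  add_nonneg (Finset.sum_nonneg fun _ _ => mul_self_nonneg _) (mul_self_nonneg _)

theorem eq_zero_of_dotR_self_nonpos (d : ℕ) (p : Rd d) (h : dotR d p p ≤ 0) : p = 0 := by
  unfold dotR at h
  have h1 : 0 ≤ ∑ i, p.1 i * p.1 i := Finset.sum_nonneg fun _ _ => mul_self_nonneg _
  have h2 := mul_self_nonneg p.2
  have h3 : ∑ i, p.1 i * p.1 i = 0 := by linarith
  have h4 : p.2 * p.2 = 0 := by linarith
  rw [Finset.sum_eq_zero_iff_of_nonneg fun _ _ => mul_self_nonneg _] at h3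
  ext i
  · simpa using h3 i (Finset.mem_univ i)
  · simpa using h4

theorem dotR_self_pos (d : ℕ) (p : Rd d) (h : p ≠ 0) : 0 < dotR d p p := by
  by_contra hc
  exact h (eq_zero_of_dotR_self_nonpos d p (not_lt.mp hc))

theorem eq_of_dotR_eq (d : ℕ) (p r : Rd d) (h : ∀ u, dotR d p u = dotR d r u) : p = r := by
  refine sub_eq_zero.mp (eq_zero_of_dotR_self_nonpos d _ ?_)
  rw [dotR_sub_left, h, sub_self]

theorem exp_le_quadratic {y t : ℝ} (ht0 : 0 ≤ t) (ht1 : t ≤ 1) :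
    Real.exp (t * y) ≤ 1 + t * y + t ^ 2 * (2 * (Real.exp (2 * y) + Real.exp (-(2 * y)))) := by
  have key : ∀ s : ℝ, Real.exp s ≤ 1 + s + s ^ 2 * Real.exp |s| := by
    intro s
    have h1 : 1 - s ≤ Real.exp (-s) := by linarith [Real.add_one_le_exp (-s)]
    have h2 : Real.exp (-s) * Real.exp s = 1 := by rw [← Real.exp_add]; simp
    have h3 : Real.exp s ≤ 1 + s * Real.exp s := by nlinarith [Real.exp_pos s]
    rcases le_total 0 s with hs | hs
    · rw [abs_of_nonneg hs]
      nlinarith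
    · have h4 : 1 ≤ Real.exp |s| := Real.one_le_exp (abs_nonneg s)
      nlinarith [Real.add_one_le_exp s, sq_nonneg s]
  have hy : y ^ 2 ≤ 2 * Real.exp |y| := by
    have := Real.quadratic_le_exp_of_nonneg (abs_nonneg y)
    have h2 := sq_abs y
    nlinarith [abs_nonneg y]
  have habs : |t * y| ≤ |y| := by
    rw [abs_mul, abs_of_nonneg ht0]
    nlinarith [abs_nonneg y]
  have h5 : Real.exp |y| * Real.exp |y| ≤ Real.exp (2 * y) + Real.exp (-(2 * y)) := by
    rw [← Real.exp_add]
    rcases le_total 0 y with h | h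
    · rw [abs_of_nonneg h, ← two_mul]
      linarith [Real.exp_pos (-(2 * y))]
    · rw [abs_of_nonpos h, show -y + -y = -(2 * y) by ring]
      linarith [Real.exp_pos (2 * y)]
  have h6 : y ^ 2 * Real.exp |t * y| ≤ 2 * (Real.exp |y| * Real.exp |y|) := by
    rw [← mul_assoc]
    exact mul_le_mul hy (Real.exp_le_exp.mpr habs) (Real.exp_pos _).le (by positivity)
  have h7 : t ^ 2 * (y ^ 2 * Real.exp |t * y|)
      ≤ t ^ 2 * (2 * (Real.exp (2 * y) + Real.exp (-(2 * y)))) :=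
    mul_le_mul_of_nonneg_left (by linarith) (sq_nonneg t)
  nlinarith [key (t * y)]

theorem summable_mul_dotZ_mul_exp {d : ℕ} {w : Zd d → ℝ} (hw : ∀ z, 0 ≤ w z)
    (hs : ∀ a, Summable fun z => w z * Real.exp (dotZ d a z)) (a v : Rd d) :
    Summable fun z => w z * dotZ d v z * Real.exp (dotZ d a z) := by
  refine Summable.of_norm_bounded ((hs (a + (1 : ℝ) • v)).add (hs (a + (-1 : ℝ) • v))) ?_
  intro z
  have hx : ∀ x : ℝ, |x| ≤ Real.exp x + Real.exp (-x) := by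
    intro x
    rw [abs_le]
    constructor <;>
    linarith [Real.add_one_le_exp x, Real.add_one_le_exp (-x), Real.exp_pos x,
      Real.exp_pos (-x)]
  rw [dotZ_add_smul, dotZ_add_smul, Real.norm_eq_abs, abs_mul, abs_mul, abs_of_nonneg (hw z),
    Real.abs_exp, Real.exp_add, Real.exp_add, one_mul, neg_one_mul]
  have h := mul_le_mul_of_nonneg_left (hx (dotZ d v z))
    (mul_nonneg (hw z) (Real.exp_pos (dotZ d a z)).le)
  linarith

/-- The directional derivative of the jump generating function. -/
theorem hasSum_dotR_jgfGrad {d : ℕ} {w : Zd d → ℝ} (hw : ∀ z, 0 ≤ w z)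
    (hs : ∀ a, Summable fun z => w z * Real.exp (dotZ d a z)) (a v : Rd d) :
    HasSum (fun z => w z * dotZ d v z * Real.exp (dotZ d a z))
      (dotR d (jgfGrad d w a) v) := by
  have h1 : ∀ i, HasSum (fun z : Zd d => w z * (z.1 i : ℝ) * Real.exp (dotZ d a z))
      ((jgfGrad d w a).1 i) := by
    intro i
    refine Summable.hasSum ?_
    simpa [dotZ, Pi.single_apply] using
      summable_mul_dotZ_mul_exp hw hs a (Pi.single i 1, 0)
  have h2 : HasSum (fun z : Zd d => w z * (z.2 : ℝ) * Real.exp (dotZ d a z))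
      ((jgfGrad d w a).2) := by
    refine Summable.hasSum ?_
    simpa [dotZ] using summable_mul_dotZ_mul_exp hw hs a (0, 1)
  have h3 := (hasSum_sum (s := Finset.univ) fun i _ => (h1 i).mul_right (v.1 i)).add
    (h2.mul_right v.2)
  refine h3.congr_fun ?_
  intro z
  simp only [dotZ, mul_add, add_mul, Finset.mul_sum, Finset.sum_mul]
  congr 1
  · exact Finset.sum_congr rfl fun i _ => by ring
  · ring

/-- A jump generating function lies above its tangent planes. -/
theorem jgf_add_dotR_jgfGrad_le {d : ℕ} {w : Zd d → ℝ} (hw : ∀ z, 0 ≤ w z)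
    (hs : ∀ a, Summable fun z => w z * Real.exp (dotZ d a z)) (a v : Rd d) :
    jgf d w a + dotR d (jgfGrad d w a) v ≤ jgf d w (a + v) := by
  refine hasSum_le ?_ ((hs a).hasSum.add (hasSum_dotR_jgfGrad hw hs a v)) (hs (a + v)).hasSum
  intro z
  have h := dotZ_add_smul d a v 1 z
  rw [one_smul, one_mul] at h
  rw [h, Real.exp_add]
  have := mul_le_mul_of_nonneg_left (Real.add_one_le_exp (dotZ d v z))
    (mul_nonneg (hw z) (Real.exp_pos (dotZ d a z)).le)
  linarith

theorem jgf_convex {d : ℕ} {w : Zd d → ℝ} (hw : ∀ z, 0 ≤ w z)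
    (hs : ∀ a, Summable fun z => w z * Real.exp (dotZ d a z)) (a b : Rd d) {t : ℝ}
    (ht0 : 0 ≤ t) (ht1 : t ≤ 1) :
    jgf d w (a + t • (b - a)) ≤ (1 - t) * jgf d w a + t * jgf d w b := by
  set c := a + t • (b - a) with hc
  have h1 := jgf_add_dotR_jgfGrad_le hw hs c (a - c)
  have h2 := jgf_add_dotR_jgfGrad_le hw hs c (b - c)
  rw [show a - c = (-t) • (b - a) by rw [hc]; module, dotR_smul_right,
    show c + (-t) • (b - a) = a by rw [hc]; module] at h1
  rw [show b - c = (1 - t) • (b - a) by rw [hc]; module, dotR_smul_right,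
    show c + (1 - t) • (b - a) = b by rw [hc]; module] at h2
  have h3 := mul_le_mul_of_nonneg_left h1 (sub_nonneg.mpr ht1)
  have h4 := mul_le_mul_of_nonneg_left h2 ht0
  linarith

theorem exists_jgf_lt {d : ℕ} {w : Zd d → ℝ} (hw : ∀ z, 0 ≤ w z)
    (hs : ∀ a, Summable fun z => w z * Real.exp (dotZ d a z)) (a v : Rd d)
    (hv : dotR d (jgfGrad d w a) v < 0) :
    ∃ δ : ℝ, 0 < δ ∧ δ ≤ 1 ∧ ∀ t : ℝ, 0 < t → t < δ → jgf d w (a + t • v) < jgf d w a := by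
  set g := dotR d (jgfGrad d w a) v with hg
  set K := 2 * (jgf d w (a + (2 : ℝ) • v) + jgf d w (a + (-2 : ℝ) • v)) with hK
  have hpos : ∀ b, 0 ≤ jgf d w b := fun b =>
    tsum_nonneg fun z => mul_nonneg (hw z) (Real.exp_pos _).le
  have hK0 : 0 ≤ K := by
    have := hpos (a + (2 : ℝ) • v)
    have := hpos (a + (-2 : ℝ) • v)
    positivity
  have hub : ∀ t : ℝ, 0 ≤ t → t ≤ 1 →
      jgf d w (a + t • v) ≤ jgf d w a + t * g + t ^ 2 * K := by
    intro t ht0 ht1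
    refine hasSum_le ?_ (hs (a + t • v)).hasSum
      (((hs a).hasSum.add ((hasSum_dotR_jgfGrad hw hs a v).mul_left t)).add
        ((((hs (a + (2 : ℝ) • v)).hasSum.add (hs (a + (-2 : ℝ) • v)).hasSum).mul_left
          2).mul_left (t ^ 2)))
    intro z
    simp only [dotZ_add_smul, Real.exp_add, neg_mul]
    have := mul_le_mul_of_nonneg_left (exp_le_quadratic (y := dotZ d v z) ht0 ht1)
      (mul_nonneg (hw z) (Real.exp_pos (dotZ d a z)).le)
    linarith
  refine ⟨min 1 (-g / (K + 1)), lt_min one_pos (div_pos (by linarith) (by linarith)),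
    min_le_left _ _, ?_⟩
  intro t ht0 ht
  have h1 := hub t ht0.le (ht.le.trans (min_le_left _ _))
  have h2 : t < -g / (K + 1) := ht.trans_le (min_le_right _ _)
  rw [lt_div_iff₀ (by linarith)] at h2
  nlinarith

theorem mem_Theta_of_le {d : ℕ} {μ μ0 : Zd d → ℝ} (hμ : ∀ z, 0 ≤ μ z)
    {α : Fin (d-1) → ℝ} {β : ℝ} (h : jgf d μ (α, β) ≤ 1) (h0 : jgf d μ0 (α, β) ≤ 1) :
    α ∈ Theta d μ μ0 := by
  change (⨅ β : ℝ, max (jgf d μ (α, β)) (jgf d μ0 (α, β))) ≤ 1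
  refine (ciInf_le ⟨0, ?_⟩ β).trans (max_le h h0)
  rintro _ ⟨b, rfl⟩
  exact le_max_of_le_left (tsum_nonneg fun z => mul_nonneg (hμ z) (Real.exp_pos _).le)

theorem exists_of_mem_Theta {d : ℕ} {μ μ0 : Zd d → ℝ} {α : Fin (d-1) → ℝ}
    (h : α ∈ Theta d μ μ0) {ε : ℝ} (hε : 0 < ε) :
    ∃ β : ℝ, jgf d μ (α, β) < 1 + ε ∧ jgf d μ0 (α, β) < 1 + ε := by
  obtain ⟨β, hβ⟩ := exists_lt_of_ciInf_lt (lt_of_le_of_lt h (lt_add_of_pos_right 1 hε))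
  exact ⟨β, (le_max_left _ _).trans_lt hβ, (le_max_right _ _).trans_lt hβ⟩

theorem Theta_convex {d : ℕ} {μ μ0 : Zd d → ℝ} (hμ : ∀ z, 0 ≤ μ z) (hμ0 : ∀ z, 0 ≤ μ0 z)
    (hs : ∀ a, Summable fun z => μ z * Real.exp (dotZ d a z))
    (hs0 : ∀ a, Summable fun z => μ0 z * Real.exp (dotZ d a z)) {a b : Rd d}
    (ha : a.1 ∈ Theta d μ μ0) (hb : b.1 ∈ Theta d μ μ0) {t : ℝ} (ht0 : 0 ≤ t) (ht1 : t ≤ 1) :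
    (a + t • (b - a)).1 ∈ Theta d μ μ0 := by
  change (⨅ β : ℝ, max (jgf d μ ((a + t • (b - a)).1, β))
    (jgf d μ0 ((a + t • (b - a)).1, β))) ≤ 1
  refine le_of_forall_pos_le_add fun ε hε => ?_
  obtain ⟨β, h1, h2⟩ := exists_of_mem_Theta ha hε
  obtain ⟨β', h3, h4⟩ := exists_of_mem_Theta hb hε
  have h5 := jgf_convex hμ hs (a.1, β) (b.1, β') ht0 ht1
  have h6 := jgf_convex hμ0 hs0 (a.1, β) (b.1, β') ht0 ht1
  refine (ciInf_le ⟨0, ?_⟩ (β + t * (β' - β))).trans (max_le (h5.trans ?_) (h6.trans ?_))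
  · rintro _ ⟨b, rfl⟩
    exact le_max_of_le_left (tsum_nonneg fun z => mul_nonneg (hμ z) (Real.exp_pos _).le)
  · nlinarith
  · nlinarith

/-- Two nonzero vectors which are not opposite lie in a common open half-space. -/
theorem exists_dotR_neg_of_not_opposite {d : ℕ} {m n : Rd d} (hm : m ≠ 0) (hn : n ≠ 0)
    (h : ‖m‖⁻¹ • m + ‖n‖⁻¹ • n ≠ 0) : ∃ u, dotR d m u < 0 ∧ dotR d n u < 0 := by
  set s := √(dotR d m m) with hs
  set t := √(dotR d n n) with ht
  have hs0 : 0 < s := Real.sqrt_pos.mpr (dotR_self_pos d m hm)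
  have ht0 : 0 < t := Real.sqrt_pos.mpr (dotR_self_pos d n hn)
  have hss : s * s = dotR d m m := Real.mul_self_sqrt (dotR_self_nonneg d m)
  have htt : t * t = dotR d n n := Real.mul_self_sqrt (dotR_self_nonneg d n)
  have hw : t • m + s • n ≠ 0 := by
    intro hc
    have h1 : m = (-(s / t)) • n := by
      have h2 : t • m = (-s) • n := by rw [neg_smul]; exact eq_neg_of_add_eq_zero_left hc
      rw [← inv_smul_smul₀ ht0.ne' m, h2, smul_smul]
      congr 1
      field_simp
    apply h
    have hst : 0 < s / t := div_pos hs0 ht0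
    rw [h1, norm_smul, norm_neg, Real.norm_of_nonneg hst.le, smul_smul, ← add_smul]
    have : (s / t * ‖n‖)⁻¹ * -(s / t) + ‖n‖⁻¹ = 0 := by
      have := norm_ne_zero_iff.mpr hn
      field_simp
      ring
    rw [this, zero_smul]
  have hpos := dotR_self_pos d _ hw
  have hmw : dotR d m (t • m + s • n) = t * (s * s) + s * dotR d m n := by
    rw [dotR_add_smul_right, dotR_smul_right, hss]
  have hnw : dotR d n (t • m + s • n) = t * dotR d m n + s * (t * t) := by
    rw [dotR_add_smul_right, dotR_smul_right, htt, dotR_comm d n m]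
  have h2 : 0 < s * t * (s * t + dotR d m n) := by
    rw [dotR_add_smul_left, dotR_smul_left, hmw, hnw] at hpos
    nlinarith
  have h3 : 0 < s * t + dotR d m n := pos_of_mul_pos_right h2 (mul_pos hs0 ht0).le
  refine ⟨(-1 : ℝ) • (t • m + s • n), ?_, ?_⟩
  · rw [dotR_smul_right, hmw]
    nlinarith [mul_pos hs0 h3]
  · rw [dotR_smul_right, hnw]
    nlinarith [mul_pos ht0 h3]

theorem jgf_zero {d : ℕ} {w : Zd d → ℝ} (hw : IsProb d w) : jgf d w 0 = 1 := by
  simpa [jgf, dotZ_zero] using hw.2.tsum_eq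

theorem jgfGrad_zero (d : ℕ) (w : Zd d → ℝ) : jgfGrad d w 0 = meanVec d w := by
  simp [jgfGrad, jgfDβ, meanVec, dotZ_zero]

theorem exists_jgf_lt_one {d : ℕ} {μ μ0 : Zd d → ℝ} (hμ : IsProb d μ) (hμ0 : IsProb d μ0)
    (hs : ∀ a, Summable fun z => μ z * Real.exp (dotZ d a z))
    (hs0 : ∀ a, Summable fun z => μ0 z * Real.exp (dotZ d a z)) (h : H3 d μ μ0) :
    ∃ b, jgf d μ b < 1 ∧ jgf d μ0 b < 1 := by
  obtain ⟨u, hu, hu0⟩ := exists_dotR_neg_of_not_opposite h.1 h.2.1 h.2.2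
  rw [← jgfGrad_zero] at hu hu0
  obtain ⟨δ, hδ, -, h1⟩ := exists_jgf_lt hμ.1 hs 0 u hu
  obtain ⟨δ', hδ', -, h2⟩ := exists_jgf_lt hμ0.1 hs0 0 u hu0
  have hm := lt_min hδ hδ'
  refine ⟨0 + (min δ δ' / 2) • u, ?_, ?_⟩
  · rw [← jgf_zero hμ]
    exact h1 _ (by linarith) (by linarith [min_le_left δ δ'])
  · rw [← jgf_zero hμ0]
    exact h2 _ (by linarith) (by linarith [min_le_right δ δ'])

/-- The normal cone to `D` at a smooth boundary point is contained in a line. -/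
theorem exists_eq_smul_jgfGrad {d : ℕ} {μ : Zd d → ℝ} (hμ : ∀ z, 0 ≤ μ z)
    (hs : ∀ a, Summable fun z => μ z * Real.exp (dotZ d a z)) {a v : Rd d}
    (ha : jgf d μ a = 1) (hv : dotR d (jgfGrad d μ a) v < 0) {p : Rd d}
    (hp : p ∈ normalCone d (Dset d μ) a) : ∃ c : ℝ, p = c • jgfGrad d μ a := by
  set g := jgfGrad d μ a with hg
  have hneg : ∀ u, dotR d g u < 0 → dotR d p u ≤ 0 := by
    intro u hu
    obtain ⟨δ, hδ, -, h⟩ := exists_jgf_lt hμ hs a u hu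
    have h1 := h (δ / 2) (by linarith) (by linarith)
    have h2 := hp (a + (δ / 2) • u) (by rw [ha] at h1; exact h1.le)
    rw [add_sub_cancel_left, dotR_smul_right] at h2
    nlinarith
  have hker : ∀ u, dotR d g u = 0 → dotR d p u = 0 := by
    intro u hu
    have h1 : ∀ s : ℝ, dotR d p v + s * dotR d p u ≤ 0 := by
      intro s
      rw [← dotR_add_smul_right]
      refine hneg _ ?_
      rw [dotR_add_smul_right, hu]
      linarith
    by_contra hne
    have h2 := h1 ((1 - dotR d p v) / dotR d p u)
    rw [div_mul_cancel₀ _ hne] at h2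
    linarith
  refine ⟨dotR d p v / dotR d g v, eq_of_dotR_eq d _ _ fun u => ?_⟩
  have h1 := hker (u + (-(dotR d g u / dotR d g v)) • v) (by
    rw [dotR_add_smul_right, neg_mul, div_mul_cancel₀ _ hv.ne]
    ring)
  rw [dotR_add_smul_right] at h1
  rw [dotR_smul_left]
  linear_combination h1

/-- A Lagrange multiplier for the affine constraint `g · (b - a) ≤ 0` on the convex set `C`, under
the Slater condition at `b₀`. -/
theorem exists_multiplier {d : ℕ} {C : Set (Rd d)} {a b₀ g q : Rd d}
    (hC : ∀ b ∈ C, ∀ b' ∈ C, ∀ t : ℝ, 0 ≤ t → t ≤ 1 → b + t • (b' - b) ∈ C)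
    (hb₀ : b₀ ∈ C) (hg : dotR d g (b₀ - a) < 0)
    (hq : ∀ b ∈ C, dotR d g (b - a) < 0 → dotR d q (b - a) ≤ 0) :
    ∃ c : ℝ, 0 ≤ c ∧ ∀ b ∈ C, dotR d q (b - a) ≤ c * dotR d g (b - a) := by
  have hmix : ∀ (p b b' : Rd d) (t : ℝ), dotR d p (b + t • (b' - b) - a)
      = (1 - t) * dotR d p (b - a) + t * dotR d p (b' - a) := by
    intro p b b' t
    rw [show b + t • (b' - b) - a = (1 - t) • (b - a) + t • (b' - a) by module,
      dotR_add_smul_right, dotR_smul_right]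
  have hzero : ∀ b ∈ C, dotR d g (b - a) = 0 → dotR d q (b - a) ≤ 0 := by
    intro b hb h0
    by_contra! hc
    set y := dotR d q (b - a)
    set y₀ := dotR d q (b₀ - a)
    have hD : 0 < y + |y₀| := by positivity
    set t := y / (2 * (y + |y₀|)) with ht
    have ht0 : 0 < t := by positivity
    have ht1 : t ≤ 1 := by
      rw [ht, div_le_one (by positivity)]
      linarith [abs_nonneg y₀]
    have htD : t * (2 * (y + |y₀|)) = y := div_mul_cancel₀ _ (by positivity)
    have h := hq _ (hC b hb b₀ hb₀ t ht0.le ht1) (by rw [hmix, h0]; nlinarith)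
    rw [hmix] at h
    have := mul_le_mul_of_nonneg_left (neg_abs_le y₀) ht0.le
    change (1 - t) * y + t * y₀ ≤ 0 at h
    nlinarith
  set S := {r : ℝ | ∃ b ∈ C, dotR d g (b - a) < 0 ∧ r = dotR d q (b - a) / dotR d g (b - a)}
    with hS
  have hSne : S.Nonempty := ⟨_, b₀, hb₀, hg, rfl⟩
  have hS0 : ∀ r ∈ S, 0 ≤ r := by
    rintro _ ⟨b, hb, hx, rfl⟩
    exact div_nonneg_of_nonpos (hq b hb hx) hx.le
  refine ⟨sInf S, le_csInf hSne hS0, fun b hb => ?_⟩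
  rcases lt_trichotomy (dotR d g (b - a)) 0 with hx | hx | hx
  · have := csInf_le ⟨0, hS0⟩ (show _ ∈ S from ⟨b, hb, hx, rfl⟩)
    rwa [le_div_iff_of_neg hx] at this
  · rw [hx, mul_zero]
    exact hzero b hb hx
  · rw [← div_le_iff₀ hx]
    refine le_csInf hSne ?_
    rintro _ ⟨b', hb', hx', rfl⟩
    rw [div_le_iff₀ hx, div_mul_eq_mul_div, le_div_iff_of_neg hx']
    set x := dotR d g (b - a)
    set x' := dotR d g (b' - a)
    set t := x / (x - x') with ht
    have hD : 0 < x - x' := by linarith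
    have htD : t * (x - x') = x := div_mul_cancel₀ _ hD.ne'
    have h := hzero _ (hC b hb b' hb' t (div_nonneg hx.le hD.le)
      (by rw [ht, div_le_one hD]; linarith)) (by rw [hmix]; linear_combination -htD)
    rw [hmix] at h
    have h2 := mul_le_mul_of_nonneg_left h hD.le
    have h3 : (x - x') * ((1 - t) * dotR d q (b - a) + t * dotR d q (b' - a))
        = -x' * dotR d q (b - a) + x * dotR d q (b' - a) := by
      linear_combination (dotR d q (b' - a) - dotR d q (b - a)) * htD
    linarith

theorem exists_mix_lt_one {x x' : ℝ} (y y' : ℝ) (hx : x < 1) (hx' : x' < 1) :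
    ∃ t : ℝ, 0 < t ∧ t ≤ 1 ∧ (1 - t) * x + t * y < 1 ∧ (1 - t) * x' + t * y' < 1 := by
  have h : ∀ x y : ℝ, x < 1 → ∀ᶠ t in nhdsWithin (0 : ℝ) (Set.Ioi 0),
      (1 - t) * x + t * y < 1 := by
    intro x y hx
    have hc : Continuous fun t : ℝ => (1 - t) * x + t * y := by fun_prop
    exact (hc.tendsto 0).eventually_lt_const (by simpa using hx) |>.filter_mono
      nhdsWithin_le_nhds
  obtain ⟨t, h1, h2, h3⟩ := ((h x y hx).and ((h x' y' hx').and
    (Ioc_mem_nhdsGT (zero_lt_one' ℝ)))).exists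
  exact ⟨t, h3.1, h3.2, h1, h2⟩

/-- On `D̂` the boundary generating function is at most `1` at the lower boundary point. -/
theorem jgf_lower_le_one {d : ℕ} {μ μ0 : Zd d → ℝ} (hμ : ∀ z, 0 ≤ μ z) (hμ0 : ∀ z, 0 ≤ μ0 z)
    (hs : ∀ a, Summable fun z => μ z * Real.exp (dotZ d a z))
    (hs0 : ∀ a, Summable fun z => μ0 z * Real.exp (dotZ d a z))
    (hup : ∀ z : Zd d, z.2 < 0 → μ0 z = 0) {α : Fin (d-1) → ℝ} {β β₁ : ℝ}
    (hα : α ∈ Theta d μ μ0) (hβ : (α, β) ∈ bdMinus d μ) (hβ₁ : jgf d μ (α, β₁) < 1) :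
    jgf d μ0 (α, β) ≤ 1 := by
  by_contra! hc
  have tangent : ∀ {w : Zd d → ℝ}, (∀ z, 0 ≤ w z) →
      (∀ a, Summable fun z => w z * Real.exp (dotZ d a z)) → ∀ x y : ℝ,
      jgf d w (α, x) + jgfDβ d w (α, x) * (y - x) ≤ jgf d w (α, y) := by
    intro w h1 h2 x y
    have h := jgf_add_dotR_jgfGrad_le h1 h2 (α, x) (0, y - x)
    simpa [dotR, jgfGrad] using h
  have hlt : β < β₁ := by
    by_contra! hle
    have h := tangent hμ hs β β₁
    rw [hβ.1] at h
    nlinarith [mul_nonneg_of_nonpos_of_nonpos hβ.2 (sub_nonpos.mpr hle)]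
  have hg0 : 0 ≤ jgfDβ d μ0 (α, β) := by
    refine tsum_nonneg fun z => ?_
    rcases lt_or_ge z.2 0 with hz | hz
    · simp [hup z hz]
    · have : (0 : ℝ) ≤ z.2 := by exact_mod_cast hz
      have := hμ0 z
      positivity
  set g := jgfDβ d μ0 (α, β) with hgdef
  set σ := (1 - jgf d μ (α, β₁)) / (β₁ - β) with hσ
  have hσ0 : 0 < σ := div_pos (by linarith) (by linarith)
  have hσm : σ * (β₁ - β) = 1 - jgf d μ (α, β₁) := div_mul_cancel₀ _ (by linarith)
  set ε := σ * (jgf d μ0 (α, β) - 1) / (σ + g) with hε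
  have hε0 : 0 < ε := div_pos (mul_pos hσ0 (by linarith)) (by linarith)
  have hεm : ε * (σ + g) = σ * (jgf d μ0 (α, β) - 1) := div_mul_cancel₀ _ (by linarith)
  obtain ⟨y, hy, hy0⟩ := exists_of_mem_Theta hα hε0
  have ht := tangent hμ0 hs0 β y
  have hyβ : y < β ∨ β ≤ y := lt_or_ge y β
  have hst : y < β → 1 + σ * (β - y) ≤ jgf d μ (α, y) := by
    intro hyβ
    have hD : 0 < β₁ - y := by linarith
    set t := (β - y) / (β₁ - y) with htdef
    have htD : t * (β₁ - y) = β - y := div_mul_cancel₀ _ hD.ne'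
    have h := jgf_convex hμ hs (α, y) (α, β₁) (t := t) (div_nonneg (by linarith) hD.le)
      (by rw [htdef, div_le_one hD]; linarith)
    rw [show ((α, y) : Rd d) + t • ((α, β₁) - (α, y)) = (α, β) by
      ext <;> simp [htD], hβ.1] at h
    have h2 := mul_le_mul_of_nonneg_right h hD.le
    have h3 : (β₁ - β) * (1 + σ * (β - y)) ≤ (β₁ - β) * jgf d μ (α, y) := by
      have e1 : ((1 - t) * jgf d μ (α, y) + t * jgf d μ (α, β₁)) * (β₁ - y)
          = (β₁ - β) * jgf d μ (α, y) + (β - y) * jgf d μ (α, β₁) := by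
        linear_combination (jgf d μ (α, β₁) - jgf d μ (α, y)) * htD
      have e2 : (β₁ - β) * (1 + σ * (β - y))
          = (β₁ - β) + (β - y) * (1 - jgf d μ (α, β₁)) := by
        linear_combination (β - y) * hσm
      linarith
    exact le_of_mul_le_mul_left h3 (by linarith)
  rcases hyβ with h | h
  · have h1 := hst h
    have h2 : g * (σ * (β - y)) ≤ g * ε := mul_le_mul_of_nonneg_left (by linarith) hg0
    have h3 : σ * (jgf d μ0 (α, β) - 1 - g * (β - y)) < σ * ε :=
      mul_lt_mul_of_pos_left (by linarith) hσ0
    linarith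
  · have h1 : 0 ≤ g * (y - β) := mul_nonneg hg0 (by linarith)
    have h2 : ε ≤ jgf d μ0 (α, β) - 1 := by
      rw [hε, div_le_iff₀ (by linarith)]
      nlinarith
    linarith

/-- Where `φ₀ < 1` at the lower boundary point, horizontal normals to `D̂` vanish. -/
theorem eq_zero_of_mem_normalCone_Dhat {d : ℕ} {μ μ0 : Zd d → ℝ} (hμ : ∀ z, 0 ≤ μ z)
    (hμ0 : ∀ z, 0 ≤ μ0 z) (hs : ∀ a, Summable fun z => μ z * Real.exp (dotZ d a z))
    (hs0 : ∀ a, Summable fun z => μ0 z * Real.exp (dotZ d a z)) {a γ : Rd d} {β β₁ : ℝ}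
    (hβ : jgf d μ (a.1, β) = 1) (h0 : jgf d μ0 (a.1, β) < 1) (hβ₁ : jgf d μ (a.1, β₁) < 1)
    (hγ : γ.2 = 0) (hγn : γ ∈ normalCone d (Dhat d μ μ0) a) : γ = 0 := by
  obtain ⟨t, ht0, ht1, ht, -⟩ := exists_mix_lt_one (jgf d μ0 (a.1, β₁)) 0 h0 one_half_lt_one
  have h1 := jgf_convex hμ hs (a.1, β) (a.1, β₁) ht0.le ht1
  have h2 := (jgf_convex hμ0 hs0 (a.1, β) (a.1, β₁) ht0.le ht1).trans_lt ht
  set c : Rd d := (a.1, β) + t • ((a.1, β₁) - (a.1, β)) with hc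
  have hc1 : c.1 = a.1 := by simp [hc]
  have h3 : jgf d μ c < 1 := by rw [hβ] at h1; nlinarith
  obtain ⟨s, hs0', hs1, hsμ, hsμ0⟩ :=
    exists_mix_lt_one (jgf d μ (c + γ)) (jgf d μ0 (c + γ)) h3 h2
  have h4 := (jgf_convex hμ hs c (c + γ) hs0'.le hs1).trans_lt hsμ
  have h5 := (jgf_convex hμ0 hs0 c (c + γ) hs0'.le hs1).trans_lt hsμ0
  rw [add_sub_cancel_left] at h4 h5
  have h6 := hγn (c + s • γ) ⟨mem_Theta_of_le hμ h4.le h5.le, h4.le⟩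
  refine eq_zero_of_dotR_self_nonpos d γ ?_
  have h7 : dotR d γ (c + s • γ - a) = s * dotR d γ γ := by
    rw [← dotR_smul_right]
    simp [dotR, hγ, hc1]
  rw [h7] at h6
  nlinarith

/-- existence and uniqueness of `γ_q ∈ ℝ^{d-1}×{0}` with
`γ_q, q-γ_q ∈ V(â(q))` and `q-γ_q` normal to `D` at `â(q)`; moreover
`φ₀(overline{â(q)}) = 1` whenever `γ_q ≠ 0`. -/
theorem gamma_q_properties
    (d : ℕ) (hd : 2 ≤ d) (μ μ0 : Zd d → ℝ)
    (hμ : IsProb d μ) (hμ0 : IsProb d μ0)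
    (hH0 : H0 d μ μ0) (hH1 : H1 d μ μ0) (hH2 : H2 d μ)
    (hH3 : H3 d μ μ0) (hH4 : H4 d μ μ0)
    (q : Rd d) (hq : 0 < q.2)
    (ahat : Rd d)
    (hahat : ahat ∈ Dhat d μ μ0 ∧ ahat ∈ bdPlus d μ ∧
      q ∈ normalCone d (Dhat d μ μ0) ahat)
    (abar : Rd d) (habar : abar ∈ bdMinus d μ ∧ abar.1 = ahat.1) :
    (∃! γ : Rd d, γ.2 = 0 ∧ (q - γ) ∈ normalCone d (Dset d μ) ahat ∧
        γ ∈ normalCone d (Dhat d μ μ0) ahat ∧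
        (q - γ) ∈ normalCone d (Dhat d μ μ0) ahat) ∧
    (∀ γ : Rd d, γ.2 = 0 → (q - γ) ∈ normalCone d (Dset d μ) ahat →
        γ ∈ normalCone d (Dhat d μ μ0) ahat →
        (q - γ) ∈ normalCone d (Dhat d μ μ0) ahat →
        γ ≠ 0 → jgf d μ0 abar = 1) := by
  have hs := fun a => (hH4 a).1
  have hs0 := fun a => (hH4 a).2
  obtain ⟨⟨haΘ, -⟩, ⟨ha1, hgβ⟩, hqn⟩ := hahat
  obtain ⟨b₀, hb₀, hb₀'⟩ := exists_jgf_lt_one hμ hμ0 hs hs0 hH3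
  set g := jgfGrad d μ ahat with hg
  have tangent : ∀ b, 1 + dotR d g (b - ahat) ≤ jgf d μ b := by
    intro b
    have h := jgf_add_dotR_jgfGrad_le hμ.1 hs ahat (b - ahat)
    rwa [ha1, add_sub_cancel] at h
  have hv : dotR d g (b₀ - ahat) < 0 := by linarith [tangent b₀]
  have hline : ∀ γ : Rd d, γ.2 = 0 → (q - γ) ∈ normalCone d (Dset d μ) ahat →
      0 < g.2 ∧ γ = q - (q.2 / g.2) • g := by
    intro γ hγ hγn
    obtain ⟨c, hc⟩ := exists_eq_smul_jgfGrad hμ.1 hs ha1 hv hγn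
    have h2 : q.2 = c * g.2 := by
      have := congrArg Prod.snd hc
      simpa [hγ] using this
    have hg2 : 0 < g.2 := by
      refine lt_of_le_of_ne hgβ fun h => ?_
      rw [← h, mul_zero] at h2
      exact hq.ne' h2
    refine ⟨hg2, ?_⟩
    rw [h2, mul_div_cancel_right₀ _ hg2.ne', ← hc, sub_sub_cancel]
  constructor
  · obtain ⟨c, hc0, hc⟩ := exists_multiplier (C := {b : Rd d | b.1 ∈ Theta d μ μ0})
      (a := ahat) (b₀ := b₀) (g := g) (q := q)
      (fun b hb b' hb' t h0 h1 => Theta_convex hμ.1 hμ0.1 hs hs0 hb hb' h0 h1)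
      (mem_Theta_of_le hμ.1 hb₀.le hb₀'.le) hv (by
        intro b hb hneg
        obtain ⟨δ, hδ, hδ1, h⟩ := exists_jgf_lt hμ.1 hs ahat (b - ahat) hneg
        have h1 := h (δ / 2) (by linarith) (by linarith)
        rw [ha1] at h1
        have h2 := hqn _ ⟨Theta_convex hμ.1 hμ0.1 hs hs0 haΘ hb (t := δ / 2) (by linarith)
          (by linarith), h1.le⟩
        rw [add_sub_cancel_left, dotR_smul_right] at h2
        nlinarith)
    have hcone : ∀ b : Rd d, b.1 ∈ Theta d μ μ0 → dotR d (q - c • g) (b - ahat) ≤ 0 := by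
      intro b hb
      rw [dotR_sub_left, dotR_smul_left]
      linarith [hc b hb]
    have hD : c • g ∈ normalCone d (Dset d μ) ahat := by
      intro b hb
      have hb1 : jgf d μ b ≤ 1 := hb
      rw [dotR_smul_left]
      exact mul_nonpos_of_nonneg_of_nonpos hc0 (by linarith [tangent b])
    have hγ2 : (q - c • g).2 = 0 := by
      have h1 := hcone (ahat + (0, 1)) (by simpa using haΘ)
      have h2 := hcone (ahat + (0, -1)) (by simpa using haΘ)
      rw [add_sub_cancel_left] at h1 h2
      simp only [dotR, Pi.zero_apply, mul_zero, Finset.sum_const_zero, zero_add] at h1 h2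
      linarith
    refine ⟨q - c • g, ⟨hγ2, ?_, fun b hb => hcone b hb.1, ?_⟩, ?_⟩
    · rwa [sub_sub_cancel]
    · rw [sub_sub_cancel]
      exact fun b hb => hD b hb.2
    · rintro γ ⟨h1, h2, -, -⟩
      rw [(hline γ h1 h2).2, (hline (q - c • g) hγ2 (by rwa [sub_sub_cancel])).2]
  · intro γ hγ hγD hγn _ hne
    obtain ⟨hg2, -⟩ := hline γ hγ hγD
    obtain ⟨hbar, hbar1⟩ := habar
    obtain ⟨δ, hδ, -, h⟩ := exists_jgf_lt hμ.1 hs ahat (0, -1) (by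
      simpa [dotR] using hg2)
    have hβ₁ := h (δ / 2) (by linarith) (by linarith)
    rw [ha1, show ahat + (δ / 2) • ((0, -1) : Rd d) = (ahat.1, ahat.2 - δ / 2) by
      ext <;> simp [sub_eq_add_neg]] at hβ₁
    have hbar' : abar = (ahat.1, abar.2) := by rw [← hbar1]
    rw [hbar'] at hbar ⊢
    refine le_antisymm (jgf_lower_le_one hμ.1 hμ0.1 hs hs0 hH0.2 haΘ hbar hβ₁) ?_
    by_contra! hlt
    exact hne (eq_zero_of_mem_normalCone_Dhat hμ.1 hμ0.1 hs hs0 hbar.1 hlt hβ₁ hγ hγn)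

end ReflectedRW
end

section
/- Under hypotheses (H0)-(H4), for every point a = (α,β) ∈ (Θ×ℝ)∩∂₊D, the constant positive multiples of h_a are the only minimal nonnegative harmonic functions h of the Markov chain (Z(t)) satisfying h(x,y) = exp(α·x)·h(0,y) for all (x,y) ∈ ℤ^{d−1}×ℕ. -/
open scoped ENNReal
open Filter MeasureTheory

namespace ReflectedRW

theorem hasSum_of_eq {ι : Type*} {f f' : ι → ℝ} {s s' : ℝ} (h : HasSum f s)
    (hf : ∀ i, f' i = f i) (hs : s' = s) : HasSum f' s' := by
  rwa [hs, funext hf]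

section HalfLine

/-- A nonnegative solution of a convolution equation `g y = ∑ A j i * g (y + i)` with weights of
total mass one that charge `i = 1` is constant. -/
theorem const_of_convolution_eq {A : ℕ → ℕ → ℝ} (hA : ∀ j i, 0 ≤ A j i) {J : ℕ} (hJ : 2 ≤ J)
    (hAJ : 0 < A J 1) (hA1 : HasSum (fun j => ∑ i ∈ Finset.range j, A j i) 1)
    {g : ℕ → ℝ} (hg : ∀ y, 0 ≤ g y)
    (hge : ∀ y, HasSum (fun j => ∑ i ∈ Finset.range j, A j i * g (y + i)) (g y)) (y : ℕ) :
    g (y + 1) = g y := by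
  have harnack : ∀ v : ℕ → ℝ, (∀ y, 0 ≤ v y) →
      (∀ y, HasSum (fun j => ∑ i ∈ Finset.range j, A j i * v (y + i)) (v y)) →
      ∀ y, v (y + 1) ≤ (A J 1)⁻¹ * v y := by
    intro v hv hve y
    rw [← div_eq_inv_mul, le_div_iff₀ hAJ, mul_comm]
    refine le_trans ?_ (le_hasSum (hve y) J fun j _ =>
      Finset.sum_nonneg fun i _ => mul_nonneg (hA _ _) (hv _))
    exact Finset.single_le_sum (f := fun i => A J i * v (y + i))
      (fun i _ => mul_nonneg (hA _ _) (hv _)) (Finset.mem_range.2 (by omega : 1 < J))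
  have hmono : ∀ y, g (y + 1) ≤ g y := by
    by_contra hcon
    set S : Set ℝ := {r | ∀ y, g (y + 1) ≤ r * g y} with hS
    have hgt : ∀ r ∈ S, 1 < r := by
      intro r hr
      by_contra hle
      push Not at hle
      exact hcon fun y => (hr y).trans (by nlinarith [hg y])
    have hne : S.Nonempty := ⟨_, harnack g hg hge⟩
    have hbdd : BddBelow S := ⟨1, fun r hr => (hgt r hr).le⟩
    set R := sInf S with hR
    have hRS : R ∈ S := by
      intro y
      rcases (hg y).eq_or_lt with h0 | h0
      · obtain ⟨r, hr⟩ := hne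
        simpa [← h0] using hr y
      · rw [← div_le_iff₀ h0]
        exact le_csInf hne fun r hr => (div_le_iff₀ h0).2 (hr y)
    have hR1 : 1 < R := hgt R hRS
    set C := (A J 1)⁻¹ with hC
    have hCpos : 0 < C := inv_pos.2 hAJ
    set v : ℕ → ℝ := fun y => R * g y - g (y + 1) with hv
    have hv0 : ∀ y, 0 ≤ v y := fun y => sub_nonneg.2 (hRS y)
    have hve : ∀ y, HasSum (fun j => ∑ i ∈ Finset.range j, A j i * v (y + i)) (v y) := by
      intro y
      refine hasSum_of_eq (((hge y).mul_left R).sub (hge (y + 1))) (fun j => ?_) rfl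
      rw [Finset.mul_sum, ← Finset.sum_sub_distrib]
      refine Finset.sum_congr rfl fun i _ => ?_
      simp only [hv, show y + 1 + i = y + i + 1 by ring]
      ring
    have hvk : ∀ y k, v (y + k) ≤ C ^ k * v y := by
      intro y k
      induction k with
      | zero => simp
      | succ k ih =>
        calc v (y + (k + 1)) ≤ C * v (y + k) := harnack v hv0 hve (y + k)
          _ ≤ C * (C ^ k * v y) := by gcongr
          _ = _ := by ring
    let B : ℕ → ℝ := fun k => Nat.rec 0 (fun k b => R * b + C ^ k) k
    have hB0 : B 0 = 0 := rfl
    have hBs : ∀ k, B (k + 1) = R * B k + C ^ k := fun k => rfl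
    have hBnn : ∀ k, 0 ≤ B k := by
      intro k
      induction k with
      | zero => exact le_rfl
      | succ k ih => rw [hBs]; positivity
    obtain ⟨N, hNJ, hN⟩ : ∃ N, J < N ∧
        1 - A J 1 * (R - 1) < ∑ j ∈ Finset.range N, ∑ i ∈ Finset.range j, A j i := by
      have h1 := hA1.tendsto_sum_nat.eventually_const_lt
        (show 1 - A J 1 * (R - 1) < 1 by nlinarith)
      obtain ⟨N, hN⟩ := (h1.and (eventually_gt_atTop J)).exists
      exact ⟨N, hN.2, hN.1⟩
    set T := ∑ j ∈ Finset.range N, ∑ i ∈ Finset.range j, A j i * R ^ i with hT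
    set U := ∑ j ∈ Finset.range N, ∑ i ∈ Finset.range j, A j i * B i with hU
    have hT1 : 1 < T := by
      have h2 : A J 1 * (R - 1) ≤
          ∑ j ∈ Finset.range N, ∑ i ∈ Finset.range j, A j i * (R ^ i - 1) := by
        have hnn : ∀ j i, 0 ≤ A j i * (R ^ i - 1) := fun j i =>
          mul_nonneg (hA _ _) (sub_nonneg.2 (one_le_pow₀ hR1.le))
        calc A J 1 * (R - 1) = A J 1 * (R ^ 1 - 1) := by rw [pow_one]
          _ ≤ ∑ i ∈ Finset.range J, A J i * (R ^ i - 1) :=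
            Finset.single_le_sum (f := fun i => A J i * (R ^ i - 1)) (fun i _ => hnn J i)
              (Finset.mem_range.2 (by omega : 1 < J))
          _ ≤ _ := Finset.single_le_sum
              (f := fun j => ∑ i ∈ Finset.range j, A j i * (R ^ i - 1))
              (fun j _ => Finset.sum_nonneg fun i _ => hnn j i) (Finset.mem_range.2 hNJ)
      have h3 : ∑ j ∈ Finset.range N, ∑ i ∈ Finset.range j, A j i * (R ^ i - 1)
          = T - ∑ j ∈ Finset.range N, ∑ i ∈ Finset.range j, A j i := by
        simp only [hT, mul_sub, mul_one, Finset.sum_sub_distrib]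
      linarith
    have hU0 : 0 ≤ U := Finset.sum_nonneg fun j _ => Finset.sum_nonneg fun i _ =>
      mul_nonneg (hA _ _) (hBnn _)
    set ε := (T - 1) / (U + 1) with hε
    have hεpos : 0 < ε := div_pos (by linarith) (by linarith)
    have hεU : ε * U < T - 1 := by
      rw [hε, div_mul_eq_mul_div, div_lt_iff₀ (by linarith)]
      nlinarith
    have hnot : R - ε ∉ S := fun hmem => by
      have := csInf_le hbdd hmem
      linarith
    obtain ⟨y, hy⟩ : ∃ y, (R - ε) * g y < g (y + 1) := by
      by_contra hno
      push Not at hno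
      exact hnot hno
    have hvy : v y < ε * g y := by simp only [hv]; linarith
    have hgy : 0 < g y := by
      by_contra h0
      have : g y = 0 := le_antisymm (not_lt.1 h0) (hg y)
      rw [this, mul_zero] at hvy
      exact absurd hvy (not_lt.2 (hv0 y))
    have hgk : ∀ k, (R ^ k - ε * B k) * g y ≤ g (y + k) := by
      intro k
      induction k with
      | zero => simp [hB0]
      | succ k ih =>
        have e1 : g (y + (k + 1)) = R * g (y + k) - v (y + k) := by
          simp only [hv]; rw [add_assoc]; ring
        have e2 : C ^ k * v y ≤ C ^ k * (ε * g y) := by gcongr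
        have e3 := mul_le_mul_of_nonneg_left ih (by linarith : (0 : ℝ) ≤ R)
        rw [e1, hBs, pow_succ]
        linarith [hvk y k]
    have hlow : (T - ε * U) * g y ≤ g y := by
      calc (T - ε * U) * g y
          = ∑ j ∈ Finset.range N, ∑ i ∈ Finset.range j, A j i * ((R ^ i - ε * B i) * g y) := by
            simp only [hT, hU, Finset.mul_sum, ← Finset.sum_sub_distrib, Finset.sum_mul]
            refine Finset.sum_congr rfl fun j _ => Finset.sum_congr rfl fun i _ => ?_
            ring
        _ ≤ ∑ j ∈ Finset.range N, ∑ i ∈ Finset.range j, A j i * g (y + i) :=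
            Finset.sum_le_sum fun j _ => Finset.sum_le_sum fun i _ =>
              mul_le_mul_of_nonneg_left (hgk i) (hA _ _)
        _ ≤ g y := sum_le_hasSum _ (fun j _ => Finset.sum_nonneg fun i _ =>
              mul_nonneg (hA _ _) (hg _)) (hge y)
    nlinarith
  have hanti : ∀ i, g (y + i) ≤ g y := fun i =>
    antitone_nat_of_succ_le hmono (Nat.le_add_right y i)
  have hdiff : HasSum (fun j => ∑ i ∈ Finset.range j, A j i * (g y - g (y + i))) 0 := by
    refine hasSum_of_eq ((hA1.mul_right (g y)).sub (hge y)) (fun j => ?_) ?_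
    · simp only [mul_sub, Finset.sum_sub_distrib, Finset.sum_mul]
    · ring
  have hnn : ∀ j i, 0 ≤ A j i * (g y - g (y + i)) := fun j i =>
    mul_nonneg (hA _ _) (sub_nonneg.2 (hanti i))
  have hz := (hasSum_zero_iff_of_nonneg
    fun j => Finset.sum_nonneg fun i _ => hnn j i).1 hdiff
  have hzJ := (Finset.sum_eq_zero_iff_of_nonneg fun i _ => hnn J i).1 (congrFun hz J) 1
    (Finset.mem_range.2 (by omega))
  rcases mul_eq_zero.1 hzJ with h | h
  · exact absurd h hAJ.ne'
  · linarith

/-- `f` is harmonic on `{1, 2, …}` for the skip-free walk on `ℕ` whose jump is `j - 1` with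
weight `p j`. -/
def IsHalfLineHarmonic (p f : ℕ → ℝ) : Prop :=
  ∀ y, HasSum (fun j => p j * f (y + j)) (f (y + 1))

/-- If `q` is the smallest positive root of `∑ p j q ^ j = q`, then nonnegative harmonic functions
satisfy `q * f y ≤ f (y + 1)`. -/
theorem IsHalfLineHarmonic.mul_le_succ {p : ℕ → ℝ} {q : ℝ} (hp : ∀ j, 0 ≤ p j) (hp0 : 0 < p 0)
    (hq : 0 < q) (hpq : HasSum (fun j => p j * q ^ j) q)
    (hmin : ∀ κ s, 0 < κ → κ < q → HasSum (fun j => p j * κ ^ j) s → κ < s)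
    {f : ℕ → ℝ} (hf : ∀ y, 0 ≤ f y) (hfh : IsHalfLineHarmonic p f) (y : ℕ) :
    q * f y ≤ f (y + 1) := by
  set S : Set ℝ := {κ | 0 ≤ κ ∧ κ ≤ q ∧ ∀ f : ℕ → ℝ, (∀ y, 0 ≤ f y) →
    IsHalfLineHarmonic p f → κ * f 0 ≤ f 1} with hS
  have h0S : (0 : ℝ) ∈ S := ⟨le_rfl, hq.le, fun f hf _ => by simpa using hf 1⟩
  have hbdd : BddAbove S := ⟨q, fun κ hκ => hκ.2.1⟩
  set κ := sSup S with hκ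
  have hκ0 : 0 ≤ κ := le_csSup hbdd h0S
  have hκq : κ ≤ q := csSup_le ⟨0, h0S⟩ fun r hr => hr.2.1
  have hκS : ∀ f : ℕ → ℝ, (∀ y, 0 ≤ f y) → IsHalfLineHarmonic p f → κ * f 0 ≤ f 1 := by
    intro f hf hfh
    rcases (hf 0).eq_or_lt with h0 | h0
    · simpa [← h0] using hf 1
    · rw [← le_div_iff₀ h0]
      exact csSup_le ⟨0, h0S⟩ fun r hr => (le_div_iff₀ h0).2 (hr.2.2 f hf hfh)
  have hstep : ∀ f : ℕ → ℝ, (∀ y, 0 ≤ f y) → IsHalfLineHarmonic p f →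
      ∀ y, κ * f y ≤ f (y + 1) := by
    intro f hf hfh y
    refine hκS (fun k => f (y + k)) (fun k => hf _) fun k => ?_
    simpa only [add_assoc] using hfh (y + k)
  have hle : ∀ j, p j * κ ^ j ≤ p j * q ^ j := fun j =>
    mul_le_mul_of_nonneg_left (pow_le_pow_left₀ hκ0 hκq j) (hp j)
  have hsum : Summable fun j => p j * κ ^ j :=
    Summable.of_nonneg_of_le (fun j => mul_nonneg (hp j) (pow_nonneg hκ0 j)) hle hpq.summable
  obtain ⟨s, hs⟩ := hsum
  have hps : p 0 ≤ s := by
    simpa using le_hasSum hs 0 fun j _ => mul_nonneg (hp j) (pow_nonneg hκ0 j)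
  have hsS : s ∈ S := by
    refine ⟨hp0.le.trans hps, hasSum_le hle hs hpq, fun f hf hfh => ?_⟩
    have hpow : ∀ k, κ ^ k * f 0 ≤ f k := by
      intro k
      induction k with
      | zero => simp
      | succ k ih =>
        calc κ ^ (k + 1) * f 0 = κ * (κ ^ k * f 0) := by ring
          _ ≤ κ * f k := by gcongr
          _ ≤ _ := hstep f hf hfh k
    refine hasSum_le (fun j => ?_) (hs.mul_right (f 0)) (hfh 0)
    rw [mul_assoc, zero_add]
    exact mul_le_mul_of_nonneg_left (hpow j) (hp j)
  have hsκ : s ≤ κ := le_csSup hbdd hsS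
  have hκeq : κ = q := by
    by_contra hne
    exact absurd (hmin κ s (hp0.trans_le (hps.trans hsκ)) (lt_of_le_of_ne hκq hne) hs)
      (not_lt.2 hsκ)
  exact hκeq ▸ hstep f hf hfh y

theorem sum_geom_mul_sub (f : ℕ → ℝ) (q : ℝ) (y j : ℕ) :
    ∑ i ∈ Finset.range j, q ^ (j - 1 - i) * (f (y + i + 1) - q * f (y + i))
      = f (y + j) - q ^ j * f y := by
  induction j with
  | zero => simp
  | succ j ih =>
    have h : ∀ i ∈ Finset.range j, q ^ (j + 1 - 1 - i) * (f (y + i + 1) - q * f (y + i))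
        = q * (q ^ (j - 1 - i) * (f (y + i + 1) - q * f (y + i))) := by
      intro i hi
      have hi := Finset.mem_range.1 hi
      rw [show j + 1 - 1 - i = (j - 1 - i) + 1 by omega, pow_succ]
      ring
    rw [Finset.sum_range_succ, Finset.sum_congr rfl h, ← Finset.mul_sum, ih]
    simp only [Nat.add_sub_cancel, Nat.sub_self, pow_zero, ← add_assoc]
    ring

/-- Nonnegative harmonic functions of a skip-free walk on the half line solve a first order
recursion. -/
theorem IsHalfLineHarmonic.exists_recursion {p : ℕ → ℝ} {q : ℝ} (hp : ∀ j, 0 ≤ p j)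
    (hp0 : 0 < p 0) {J : ℕ} (hJ : 2 ≤ J) (hpJ : 0 < p J) (hq : 0 < q)
    (hp1 : HasSum p 1) (hpq : HasSum (fun j => p j * q ^ j) q)
    (hdrift : q = 1 → HasSum (fun j => p j * (j : ℝ)) 1)
    (hmin : ∀ κ s, 0 < κ → κ < q → HasSum (fun j => p j * κ ^ j) s → κ < s)
    {f : ℕ → ℝ} (hf : ∀ y, 0 ≤ f y) (hfh : IsHalfLineHarmonic p f) :
    ∃ G, ∀ y, f (y + 1) = q * f y + G := by
  set g : ℕ → ℝ := fun y => f (y + 1) - q * f y with hg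
  have hconst : ∀ y, g (y + 1) = g y := by
    refine const_of_convolution_eq (A := fun j i => p j * q ^ (j - 1 - i)) (J := J)
      (fun j i => mul_nonneg (hp j) (pow_nonneg hq.le _)) hJ (mul_pos hpJ (pow_pos hq _)) ?_
      (fun y => sub_nonneg.2 (hfh.mul_le_succ hp hp0 hq hpq hmin hf y)) fun y => ?_
    · rcases eq_or_ne q 1 with h1 | h1
      · simpa [h1, mul_comm] using hdrift h1
      · have hne : (1 : ℝ) - q ≠ 0 := sub_ne_zero.2 h1.symm
        refine hasSum_of_eq ((hp1.sub hpq).div_const (1 - q)) (fun j => ?_) ?_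
        · have := sum_geom_mul_sub (fun _ => 1) q 0 j
          simp only [mul_one, ← Finset.sum_mul] at this
          rw [eq_div_iff hne, ← Finset.mul_sum, mul_assoc, this]
          ring
        · rw [div_self hne]
    · refine hasSum_of_eq ((hfh y).sub (hpq.mul_right (f y))) (fun j => ?_) rfl
      simp only [hg, mul_assoc, ← Finset.mul_sum, sum_geom_mul_sub]
      ring
  refine ⟨g 0, fun y => ?_⟩
  have : g y = g 0 := by
    induction y with
    | zero => rfl
    | succ y ih => rw [hconst, ih]
  rw [← this]
  simp only [hg]
  ring

end HalfLine

section Kernel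

theorem exists_of_kerIter_succ_ne_zero {S : Type*} [DecidableEq S] {p : S → S → ℝ≥0∞} {n : ℕ}
    {z z' : S} (h : kerIter p (n + 1) z z' ≠ 0) : ∃ w, kerIter p n z w ≠ 0 ∧ p w z' ≠ 0 := by
  by_contra hcon
  push Not at hcon
  refine h (ENNReal.tsum_eq_zero.2 fun w => ?_)
  rcases eq_or_ne (kerIter p n z w) 0 with h0 | h0
  · rw [h0, zero_mul]
  · rw [hcon w h0, mul_zero]

theorem kerIter_invariant {S : Type*} [DecidableEq S] {p : S → S → ℝ≥0∞} {P : S → Prop}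
    (hP : ∀ w w', P w → p w w' ≠ 0 → P w') {n : ℕ} {z z' : S} (hz : P z)
    (h : kerIter p n z z' ≠ 0) : P z' := by
  induction n generalizing z' with
  | zero =>
    by_cases he : z = z'
    · exact he ▸ hz
    · simp [kerIter, he] at h
  | succ n ih =>
    obtain ⟨w, hw, hw'⟩ := exists_of_kerIter_succ_ne_zero h
    exact hP w z' (ih hw) hw'

end Kernel

section Jumps

variable {d : ℕ} {μ μ0 : Zd d → ℝ}

theorem exists_jump_down (hH0 : H0 d μ μ0) (hH1 : H1 d μ μ0) :
    ∃ z : Zd d, z.2 = -1 ∧ 0 < μ z := by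
  by_contra hcon
  push Not at hcon
  obtain ⟨n, hn⟩ := hH1 (0, 1) (0, 0)
  have := kerIter_invariant (P := fun z : St d => 1 ≤ z.2) (fun w w' hw hww' => ?_) le_rfl hn.ne'
  · simp at this
  · have hw0 : w.2 ≠ 0 := by omega
    rw [step, if_neg hw0, ne_eq, ENNReal.ofReal_eq_zero, not_le] at hww'
    by_contra hlt
    have hz2 : (toZ d w' - toZ d w).2 = (w'.2 : ℤ) - w.2 := rfl
    rcases lt_or_ge (toZ d w' - toZ d w).2 (-1) with h | h
    · exact hww'.ne' (hH0.1 _ h)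
    · exact absurd hww' (not_lt.2 (hcon _ (by omega)))

theorem exists_jump_up (hH2 : H2 d μ) : ∃ z : Zd d, 1 ≤ z.2 ∧ 0 < μ z := by
  by_contra hcon
  push Not at hcon
  obtain ⟨n, hn⟩ := hH2.1 (0, 0) (0, 1)
  have := kerIter_invariant (P := fun z : Zd d => z.2 ≤ 0) (fun w w' hw hww' => ?_) le_rfl hn.ne'
  · simp at this
  · rw [stepS, ne_eq, ENNReal.ofReal_eq_zero, not_le] at hww'
    by_contra hlt
    have hz2 : (w' - w).2 = w'.2 - w.2 := rfl
    exact absurd hww' (not_lt.2 (hcon _ (by omega)))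

theorem exists_boundary_jump_up (hH1 : H1 d μ μ0) :
    ∃ z : Zd d, 1 ≤ z.2 ∧ 0 < μ0 z := by
  by_contra hcon
  push Not at hcon
  obtain ⟨n, hn⟩ := hH1 (0, 0) (0, 1)
  have := kerIter_invariant (P := fun z : St d => z.2 = 0) (fun w w' hw hww' => ?_) rfl hn.ne'
  · simp at this
  · rw [step, if_pos hw, ne_eq, ENNReal.ofReal_eq_zero, not_le] at hww'
    by_contra hlt
    have hz2 : (toZ d w' - toZ d w).2 = (w'.2 : ℤ) - w.2 := rfl
    exact absurd hww' (not_lt.2 (hcon _ (by omega)))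

end Jumps

section GeneratingFunction

variable {d : ℕ} {ν : Zd d → ℝ}

theorem dotZ_add (a : Rd d) (z w : Zd d) : dotZ d a (z + w) = dotZ d a z + dotZ d a w := by
  simp only [dotZ, Prod.fst_add, Prod.snd_add, Pi.add_apply, Int.cast_add, mul_add,
    Finset.sum_add_distrib]
  ring

theorem dotZ_eq_add_of_fst_eq {a b : Rd d} (h : b.1 = a.1) (z : Zd d) :
    dotZ d b z = dotZ d a z + (b.2 - a.2) * z.2 := by
  simp only [dotZ, h]
  ring

theorem hasSum_jgf (hν : ∀ a : Rd d, Summable fun z => ν z * Real.exp (dotZ d a z)) (a : Rd d) :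
    HasSum (fun z => ν z * Real.exp (dotZ d a z)) (jgf d ν a) :=
  (hν a).hasSum

theorem hasSum_jgfDβ (hν0 : ∀ z, 0 ≤ ν z)
    (hν : ∀ a : Rd d, Summable fun z => ν z * Real.exp (dotZ d a z)) (a : Rd d) :
    HasSum (fun z => ν z * (z.2 : ℝ) * Real.exp (dotZ d a z)) (jgfDβ d ν a) := by
  refine Summable.hasSum (Summable.of_norm_bounded
    ((hν (a.1, a.2 + 1)).add (hν (a.1, a.2 - 1))) fun z => ?_)
  rw [dotZ_eq_add_of_fst_eq (a := a) (b := (a.1, a.2 + 1)) rfl,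
    dotZ_eq_add_of_fst_eq (a := a) (b := (a.1, a.2 - 1)) rfl, Real.exp_add, Real.exp_add,
    norm_mul, norm_mul, Real.norm_of_nonneg (hν0 z), Real.norm_of_nonneg (Real.exp_pos _).le,
    Real.norm_eq_abs]
  have h1 := Real.add_one_le_exp (z.2 : ℝ)
  have h2 := Real.add_one_le_exp (-(z.2 : ℝ))
  have h3 : |(z.2 : ℝ)| ≤ Real.exp z.2 + Real.exp (-(z.2 : ℝ)) := by
    rw [abs_le]
    constructor <;> linarith [Real.exp_pos (z.2 : ℝ), Real.exp_pos (-(z.2 : ℝ))]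
  have h4 : 0 ≤ ν z * Real.exp (dotZ d a z) := mul_nonneg (hν0 z) (Real.exp_pos _).le
  have h5 := mul_le_mul_of_nonneg_left h3 h4
  simp only [add_sub_cancel_left, one_mul, sub_sub_cancel_left, neg_one_mul]
  linarith

/-- Gradient inequality for the convex function `β ↦ φ(α, β)`. -/
theorem jgf_tangent_le (hν0 : ∀ z, 0 ≤ ν z)
    (hν : ∀ a : Rd d, Summable fun z => ν z * Real.exp (dotZ d a z)) {a b : Rd d}
    (h : b.1 = a.1) : jgf d ν a + jgfDβ d ν a * (b.2 - a.2) ≤ jgf d ν b := by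
  refine hasSum_le (fun z => ?_) ((hasSum_jgf hν a).add
    ((hasSum_jgfDβ hν0 hν a).mul_right (b.2 - a.2))) (hasSum_jgf hν b)
  rw [dotZ_eq_add_of_fst_eq h, Real.exp_add]
  have h1 := mul_le_mul_of_nonneg_left (Real.add_one_le_exp ((b.2 - a.2) * (z.2 : ℝ)))
    (mul_nonneg (hν0 z) (Real.exp_pos (dotZ d a z)).le)
  linarith

theorem jgf_tangent_lt (hν0 : ∀ z, 0 ≤ ν z)
    (hν : ∀ a : Rd d, Summable fun z => ν z * Real.exp (dotZ d a z))
    (hz : ∃ z : Zd d, z.2 ≠ 0 ∧ 0 < ν z) {a b : Rd d} (h : b.1 = a.1) (hne : b.2 ≠ a.2) :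
    jgf d ν a + jgfDβ d ν a * (b.2 - a.2) < jgf d ν b := by
  obtain ⟨z0, hz0, hpos⟩ := hz
  refine hasSum_lt (i := z0) (fun z => ?_) ?_ ((hasSum_jgf hν a).add
    ((hasSum_jgfDβ hν0 hν a).mul_right (b.2 - a.2))) (hasSum_jgf hν b)
  · rw [dotZ_eq_add_of_fst_eq h, Real.exp_add]
    have h1 := mul_le_mul_of_nonneg_left (Real.add_one_le_exp ((b.2 - a.2) * (z.2 : ℝ)))
      (mul_nonneg (hν0 z) (Real.exp_pos (dotZ d a z)).le)
    linarith
  · rw [dotZ_eq_add_of_fst_eq h, Real.exp_add]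
    have hne' : (b.2 - a.2) * (z0.2 : ℝ) ≠ 0 :=
      mul_ne_zero (sub_ne_zero.2 hne) (Int.cast_ne_zero.2 hz0)
    have h1 := mul_lt_mul_of_pos_left (Real.add_one_lt_exp hne')
      (mul_pos hpos (Real.exp_pos (dotZ d a z0)))
    linarith

theorem jgfDβ_pos (hν0 : ∀ z, 0 ≤ ν z)
    (hν : ∀ a : Rd d, Summable fun z => ν z * Real.exp (dotZ d a z))
    (hneg : ∀ z : Zd d, z.2 < 0 → ν z = 0) (hz : ∃ z : Zd d, 1 ≤ z.2 ∧ 0 < ν z) (a : Rd d) :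
    0 < jgfDβ d ν a := by
  obtain ⟨z0, hz0, hpos⟩ := hz
  refine (hasSum_jgfDβ hν0 hν a).summable.tsum_pos (fun z => ?_) z0 ?_
  · rcases lt_or_ge z.2 0 with h | h
    · simp [hneg z h]
    · exact mul_nonneg (mul_nonneg (hν0 z) (Int.cast_nonneg h)) (Real.exp_pos _).le
  · exact mul_pos (mul_pos hpos (Int.cast_pos.2 (by omega))) (Real.exp_pos _)

/-- Two points of `∂₊D` and `∂₋D` with the same first coordinates are ordered. -/
theorem snd_le_of_bdMinus_of_bdPlus (hν0 : ∀ z, 0 ≤ ν z)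
    (hν : ∀ a : Rd d, Summable fun z => ν z * Real.exp (dotZ d a z))
    (hz : ∃ z : Zd d, z.2 ≠ 0 ∧ 0 < ν z) {a b : Rd d} (ha : a ∈ bdPlus d ν)
    (hb : b ∈ bdMinus d ν) (h : b.1 = a.1) : b.2 ≤ a.2 := by
  by_contra hlt
  push Not at hlt
  have h1 := jgf_tangent_lt hν0 hν hz h hlt.ne'
  rw [ha.1, hb.1] at h1
  nlinarith [ha.2]

theorem jgf_zero_le_one_of_mem_Theta {μ μ0 : Zd d → ℝ} (hμ : ∀ z, 0 ≤ μ z) (hμ0 : ∀ z, 0 ≤ μ0 z)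
    (hH4 : H4 d μ μ0) (hD0 : ∀ a : Rd d, 0 < jgfDβ d μ0 a)
    (hz : ∃ z : Zd d, z.2 ≠ 0 ∧ 0 < μ z) {b : Rd d} (hθ : b.1 ∈ Theta d μ μ0)
    (hb : b ∈ bdMinus d μ) : jgf d μ0 b ≤ 1 := by
  have hs := fun a => (hH4 a).1
  have hs0 := fun a => (hH4 a).2
  by_contra hlt
  push Not at hlt
  obtain ⟨δ, hδ, hδ1⟩ : ∃ δ > 0, 1 < jgf d μ0 b - jgfDβ d μ0 b * δ := by
    refine ⟨(jgf d μ0 b - 1) / (2 * jgfDβ d μ0 b),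
      div_pos (by linarith) (by linarith [hD0 b]), ?_⟩
    have := (hD0 b).ne'
    have e : jgfDβ d μ0 b * ((jgf d μ0 b - 1) / (2 * jgfDβ d μ0 b)) = (jgf d μ0 b - 1) / 2 := by
      field_simp
    rw [e]
    linarith
  set c : Rd d := (b.1, b.2 - δ) with hc
  have hcb : b.2 - c.2 = δ := by simp [hc]
  have h1 : 1 < jgf d μ0 c := by
    have := jgf_tangent_le hμ0 hs0 (a := b) (b := c) rfl
    have e : c.2 - b.2 = -δ := by linarith
    rw [e] at this
    linarith
  have h2 : 1 < jgf d μ c := by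
    have := jgf_tangent_lt hμ hs hz (a := b) (b := c) rfl (by intro h; linarith)
    have e : c.2 - b.2 = -δ := by linarith
    rw [e, hb.1] at this
    nlinarith [hb.2]
  have h3 : jgfDβ d μ c < 0 := by
    have := jgf_tangent_le hμ hs (a := c) (b := b) rfl
    rw [hcb, hb.1] at this
    by_contra h
    nlinarith
  have h4 : min (jgf d μ c) (jgf d μ0 c) ≤ 1 := by
    refine le_trans (le_ciInf fun β => ?_) hθ
    rcases le_total c.2 β with h | h
    · refine (min_le_right _ _).trans (le_max_of_le_right ?_)
      have := jgf_tangent_le hμ0 hs0 (a := c) (b := (b.1, β)) rfl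
      nlinarith [mul_nonneg (hD0 c).le (sub_nonneg.2 h)]
    · refine (min_le_left _ _).trans (le_max_of_le_left ?_)
      have := jgf_tangent_le hμ hs (a := c) (b := (b.1, β)) rfl
      nlinarith [mul_nonneg (neg_nonneg.2 h3.le) (sub_nonneg.2 h)]
  exact absurd h4 (not_le.2 (lt_min h2 h1))

end GeneratingFunction

section Harmonic

variable {d : ℕ} {μ μ0 : Zd d → ℝ}

/-- The law of the jump of the reflected walk from `z`. -/
noncomputable def jump (d : ℕ) (μ μ0 : Zd d → ℝ) (z : St d) : Zd d → ℝ :=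
  if z.2 = 0 then μ0 else μ

theorem stepR_eq_jump (z z' : St d) :
    stepR d μ μ0 z z' = jump d μ μ0 z (toZ d z' - toZ d z) := by
  unfold stepR jump
  split <;> rfl

theorem jump_nonneg (hμ : ∀ z, 0 ≤ μ z) (hμ0 : ∀ z, 0 ≤ μ0 z) (z : St d) (w : Zd d) :
    0 ≤ jump d μ μ0 z w := by
  unfold jump
  split
  exacts [hμ0 w, hμ w]

theorem jump_eq_zero (hH0 : H0 d μ μ0) (z : St d) (w : Zd d) (h : (z.2 : ℤ) + w.2 < 0) :
    jump d μ μ0 z w = 0 := by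
  unfold jump
  split
  · exact hH0.2 w (by omega)
  · exact hH0.1 w (by omega)

theorem summable_jump (hH4 : H4 d μ μ0) (z : St d) (a : Rd d) :
    Summable fun w => jump d μ μ0 z w * Real.exp (dotZ d a w) := by
  unfold jump
  split
  exacts [(hH4 a).2, (hH4 a).1]

theorem hasSum_comp_toZ_sub (z : St d) {ψ : Zd d → ℝ} {s : ℝ}
    (hψ : ∀ w : Zd d, (z.2 : ℤ) + w.2 < 0 → ψ w = 0) :
    HasSum (fun z' => ψ (toZ d z' - toZ d z)) s ↔ HasSum ψ s := by
  have hinj : Function.Injective fun z' : St d => toZ d z' - toZ d z := by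
    intro z' z'' h
    have h' := sub_left_injective h
    simp only [toZ, Prod.mk.injEq, Nat.cast_inj] at h'
    exact Prod.ext h'.1 h'.2
  refine hinj.hasSum_iff fun w hw => hψ w ?_
  by_contra hlt
  push Not at hlt
  refine hw ⟨(z.1 + w.1, ((z.2 : ℤ) + w.2).toNat), ?_⟩
  refine Prod.ext ?_ ?_
  · simp [toZ]
  · simp [toZ, Int.toNat_of_nonneg hlt]

theorem hasSum_stepR_mul_exp (hH0 : H0 d μ μ0) (hH4 : H4 d μ μ0) (b : Rd d) (z : St d) :
    HasSum (fun z' => stepR d μ μ0 z z' * Real.exp (dotZ d b (toZ d z')))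
      (jgf d (jump d μ μ0 z) b * Real.exp (dotZ d b (toZ d z))) := by
  refine hasSum_of_eq ((hasSum_comp_toZ_sub z (fun w hw => ?_)).2
    ((hasSum_jgf (summable_jump hH4 z) b).mul_right (Real.exp (dotZ d b (toZ d z)))))
    (fun z' => ?_) rfl
  · rw [jump_eq_zero hH0 z w hw, zero_mul, zero_mul]
  · rw [stepR_eq_jump, mul_assoc, ← Real.exp_add, ← dotZ_add, sub_add_cancel]

theorem hasSum_stepR_mul_snd_mul_exp (hμ : ∀ z, 0 ≤ μ z) (hμ0 : ∀ z, 0 ≤ μ0 z)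
    (hH0 : H0 d μ μ0) (hH4 : H4 d μ μ0) (b : Rd d) (z : St d) :
    HasSum (fun z' => stepR d μ μ0 z z' * ((z'.2 : ℝ) * Real.exp (dotZ d b (toZ d z'))))
      (((z.2 : ℝ) * jgf d (jump d μ μ0 z) b + jgfDβ d (jump d μ μ0 z) b)
        * Real.exp (dotZ d b (toZ d z))) := by
  refine hasSum_of_eq ((hasSum_comp_toZ_sub z (fun w hw => ?_)).2
    ((((hasSum_jgf (summable_jump hH4 z) b).mul_left (z.2 : ℝ)).add
      (hasSum_jgfDβ (jump_nonneg hμ hμ0 z) (summable_jump hH4 z) b)).mul_right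
        (Real.exp (dotZ d b (toZ d z))))) (fun z' => ?_) rfl
  · simp [jump_eq_zero hH0 z w hw]
  · have e : dotZ d b (toZ d z') = dotZ d b (toZ d z' - toZ d z) + dotZ d b (toZ d z) := by
      rw [← dotZ_add, sub_add_cancel]
    have e2 : ((toZ d z' - toZ d z).2 : ℝ) = (z'.2 : ℝ) - z.2 := by
      simp [toZ]
    rw [stepR_eq_jump, e, Real.exp_add, e2]
    ring

theorem IsHarmonic.const_mul {h : St d → ℝ} (hh : IsHarmonic d μ μ0 h) (c : ℝ) :
    IsHarmonic d μ μ0 fun z => c * h z := fun z =>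
  hasSum_of_eq ((hh z).mul_left c) (fun z' => by ring) rfl

theorem IsHarmonic.sub {h k : St d → ℝ} (hh : IsHarmonic d μ μ0 h) (hk : IsHarmonic d μ μ0 k) :
    IsHarmonic d μ μ0 fun z => h z - k z := fun z =>
  hasSum_of_eq ((hh z).sub (hk z)) (fun z' => by ring) rfl

theorem IsHarmonic.translate {h : St d → ℝ} (hh : IsHarmonic d μ μ0 h) (u : Fin (d - 1) → ℤ) :
    IsHarmonic d μ μ0 fun z => h (z.1 + u, z.2) := by
  intro z
  refine hasSum_of_eq ((((Equiv.addRight u).prodCongr (Equiv.refl ℕ)).hasSum_iff).2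
    (hh (z.1 + u, z.2))) (fun z' => ?_) rfl
  have e : toZ d (z'.1 + u, z'.2) - toZ d (z.1 + u, z.2) = toZ d z' - toZ d z := by
    simp [toZ]
  change stepR d μ μ0 z z' * h (z'.1 + u, z'.2)
    = stepR d μ μ0 (z.1 + u, z.2) (z'.1 + u, z'.2) * h (z'.1 + u, z'.2)
  simp [stepR, e]

theorem IsHarmonic.stepR_mul_le (hμ : ∀ z, 0 ≤ μ z) (hμ0 : ∀ z, 0 ≤ μ0 z) {g : St d → ℝ}
    (hg : IsHarmonic d μ μ0 g) (hg0 : ∀ z, 0 ≤ g z) (z z' : St d) :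
    stepR d μ μ0 z z' * g z' ≤ g z :=
  le_hasSum (hg z) z' fun w _ => mul_nonneg
    (by rw [stepR_eq_jump]; exact jump_nonneg hμ hμ0 _ _) (hg0 w)

theorem exists_harnack_of_stepn_ne_zero (hμ : ∀ z, 0 ≤ μ z) (hμ0 : ∀ z, 0 ≤ μ0 z) {n : ℕ}
    {z z' : St d} (h : stepn d μ μ0 n z z' ≠ 0) :
    ∃ ε > 0, ∀ g : St d → ℝ, IsHarmonic d μ μ0 g → (∀ z, 0 ≤ g z) →
      ∀ t, ε * g (z'.1 + t, z'.2) ≤ g (z.1 + t, z.2) := by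
  induction n generalizing z' with
  | zero =>
    by_cases he : z = z'
    · exact ⟨1, one_pos, fun g _ _ t => by rw [he, one_mul]⟩
    · simp [stepn, kerIter, he] at h
  | succ n ih =>
    obtain ⟨w, hw, hw'⟩ := exists_of_kerIter_succ_ne_zero h
    obtain ⟨ε, hε, hH⟩ := ih hw
    have hpos : 0 < stepR d μ μ0 w z' := by
      unfold step at hw'
      unfold stepR
      split at hw' <;> rename_i h0 <;>
        simpa [h0] using hw'
    refine ⟨ε * stepR d μ μ0 w z', mul_pos hε hpos, fun g hg hg0 t => ?_⟩
    have e : stepR d μ μ0 (w.1 + t, w.2) (z'.1 + t, z'.2) = stepR d μ μ0 w z' := by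
      have : toZ d (z'.1 + t, z'.2) - toZ d (w.1 + t, w.2) = toZ d z' - toZ d w := by
        simp [toZ]
      simp [stepR, this]
    calc ε * stepR d μ μ0 w z' * g (z'.1 + t, z'.2)
        = ε * (stepR d μ μ0 (w.1 + t, w.2) (z'.1 + t, z'.2) * g (z'.1 + t, z'.2)) := by
          rw [e, mul_assoc]
      _ ≤ ε * g (w.1 + t, w.2) := by
          gcongr
          exact hg.stepR_mul_le hμ hμ0 hg0 _ _
      _ ≤ _ := hH g hg hg0 t

theorem exists_harnack_of_stepSn_ne_zero (hμ : ∀ z, 0 ≤ μ z) (hμ0 : ∀ z, 0 ≤ μ0 z)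
    (hH0 : H0 d μ μ0) {n : ℕ} {z z' : Zd d} (h : stepSn d μ n z z' ≠ 0) :
    z.2 - n ≤ z'.2 ∧ ∃ ε > 0, ∀ g : St d → ℝ, IsHarmonic d μ μ0 g → (∀ z, 0 ≤ g z) →
      ∀ w w' : St d, n < w.2 → toZ d w' - toZ d w = z' - z → ε * g w' ≤ g w := by
  induction n generalizing z' with
  | zero =>
    by_cases he : z = z'
    · refine ⟨by simp [he], 1, one_pos, fun g _ _ w w' _ hww' => ?_⟩
      rw [he, sub_self, sub_eq_zero] at hww'
      simp only [toZ, Prod.mk.injEq, Nat.cast_inj] at hww'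
      rw [one_mul, Prod.ext hww'.1 hww'.2]
    · simp [stepSn, kerIter, he] at h
  | succ n ih =>
    obtain ⟨v, hv, hv'⟩ := exists_of_kerIter_succ_ne_zero h
    obtain ⟨hle, ε, hε, hH⟩ := ih hv
    have hpos : 0 < μ (z' - v) := by simpa [stepS] using hv'
    have hdown : -1 ≤ (z' - v).2 := by
      by_contra hlt
      exact hpos.ne' (hH0.1 _ (not_le.1 hlt))
    have hdown' : -1 ≤ z'.2 - v.2 := hdown
    refine ⟨by push_cast; omega, ε * μ (z' - v), mul_pos hε hpos, fun g hg hg0 w w' hw hww' => ?_⟩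
    set m : St d := (w.1 + (v - z).1, ((w.2 : ℤ) + (v - z).2).toNat) with hm
    have hvz : (v - z).2 = v.2 - z.2 := rfl
    have hm2 : (m.2 : ℤ) = w.2 + (v - z).2 := by
      simp only [hm]
      rw [Int.toNat_of_nonneg]
      omega
    have hmw : toZ d m - toZ d w = v - z := by
      refine Prod.ext ?_ ?_
      · simp [toZ, hm]
      · simp only [toZ, Prod.snd_sub, hm2]
        ring
    have hm0 : m.2 ≠ 0 := by omega
    have hwm : toZ d w' - toZ d m = z' - v := by
      rw [← sub_sub_sub_cancel_right _ _ (toZ d w), hww', hmw, sub_sub_sub_cancel_right]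
    calc ε * μ (z' - v) * g w' = ε * (stepR d μ μ0 m w' * g w') := by
          rw [stepR, if_neg hm0, hwm, mul_assoc]
      _ ≤ ε * g m := by
          gcongr
          exact hg.stepR_mul_le hμ hμ0 hg0 _ _
      _ ≤ _ := hH g hg hg0 w m (by omega) hmw

/-- Harnack inequality, uniform over the half space, for translations along the boundary. -/
theorem exists_harnack (hμ : ∀ z, 0 ≤ μ z) (hμ0 : ∀ z, 0 ≤ μ0 z) (hH0 : H0 d μ μ0)
    (hH1 : H1 d μ μ0) (hH2 : H2 d μ) (u : Fin (d - 1) → ℤ) :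
    ∃ C > 0, ∀ g : St d → ℝ, IsHarmonic d μ μ0 g → (∀ z, 0 ≤ g z) →
      ∀ z, g (z.1 + u, z.2) ≤ C * g z := by
  obtain ⟨n, hn⟩ := hH2.1 0 (u, 0)
  obtain ⟨-, ε, hε, hint⟩ := exists_harnack_of_stepSn_ne_zero hμ hμ0 hH0 hn.ne'
  have hbd : ∀ y : ℕ, ∃ δ > 0, ∀ g : St d → ℝ, IsHarmonic d μ μ0 g → (∀ z, 0 ≤ g z) →
      ∀ x, δ * g (x + u, y) ≤ g (x, y) := by
    intro y
    obtain ⟨k, hk⟩ := hH1 (0, y) (u, y)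
    obtain ⟨δ, hδ, H⟩ := exists_harnack_of_stepn_ne_zero hμ hμ0 hk.ne'
    refine ⟨δ, hδ, fun g hg hg0 x => ?_⟩
    simpa [add_comm] using H g hg hg0 x
  choose δ hδ hbd using hbd
  have hsum : 0 ≤ ∑ y ∈ Finset.range (n + 1), (δ y)⁻¹ :=
    Finset.sum_nonneg fun y _ => (inv_pos.2 (hδ y)).le
  have hε' := inv_pos.2 hε
  refine ⟨ε⁻¹ + ∑ y ∈ Finset.range (n + 1), (δ y)⁻¹, by positivity, fun g hg hg0 z => ?_⟩
  rcases lt_or_ge n z.2 with hz | hz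
  · have h1 := hint g hg hg0 z (z.1 + u, z.2) hz (by simp [toZ])
    rw [← le_div_iff₀' hε, div_eq_inv_mul] at h1
    exact h1.trans (mul_le_mul_of_nonneg_right (le_add_of_nonneg_right hsum) (hg0 z))
  · have h1 := hbd z.2 g hg hg0 z.1
    rw [← le_div_iff₀' (hδ _), div_eq_inv_mul] at h1
    refine h1.trans (mul_le_mul_of_nonneg_right ?_ (hg0 z))
    exact (Finset.single_le_sum (f := fun y => (δ y)⁻¹) (fun y _ => (inv_pos.2 (hδ y)).le)
      (Finset.mem_range.2 (Nat.lt_succ_of_le hz))).trans (le_add_of_nonneg_left hε'.le)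

/-- Choquet–Deny type argument: a nonnegative harmonic function dominated by a harmonic function
that is multiplied by `r` under the translation by `u` has no increments along `u`. -/
theorem le_inv_mul_translate {H h : St d → ℝ} {u : Fin (d - 1) → ℤ} {C r : ℝ} (hC : 0 < C)
    (hharnack : ∀ g : St d → ℝ, IsHarmonic d μ μ0 g → (∀ z, 0 ≤ g z) →
      ∀ z, g (z.1 + u, z.2) ≤ C * g z)
    (hr : 0 < r) (hH : IsHarmonic d μ μ0 H) (hH0 : ∀ z, 0 ≤ H z)
    (hHr : ∀ z, H (z.1 + u, z.2) = r * H z)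
    (hh : IsHarmonic d μ μ0 h) (hh0 : ∀ z, 0 ≤ h z) (hle : ∀ z, h z ≤ H z) (z : St d) :
    h z ≤ r⁻¹ * h (z.1 + u, z.2) := by
  have hr' := inv_pos.2 hr
  set v : St d → ℝ := fun z => h z - r⁻¹ * h (z.1 + u, z.2) with hv
  suffices ∀ z, v z ≤ 0 from sub_nonpos.1 (this z)
  by_contra hcon
  set S : Set ℝ := {m | ∀ z, v z ≤ m * H z} with hS
  have hpos : ∀ m ∈ S, 0 < m := by
    intro m hm
    by_contra hle
    exact hcon fun z => (hm z).trans (mul_nonpos_of_nonpos_of_nonneg (not_lt.1 hle) (hH0 z))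
  have hne : S.Nonempty := ⟨1, fun z => by
    have := mul_nonneg hr'.le (hh0 (z.1 + u, z.2))
    simp only [hv, one_mul]
    linarith [hle z]⟩
  have hbdd : BddBelow S := ⟨0, fun m hm => (hpos m hm).le⟩
  set M := sInf S with hM
  have hMS : M ∈ S := by
    intro z
    rcases (hH0 z).eq_or_lt with h0 | h0
    · obtain ⟨m, hm⟩ := hne
      simpa [← h0] using hm z
    · rw [← div_le_iff₀ h0]
      exact le_csInf hne fun m hm => (div_le_iff₀ h0).2 (hm z)
  have hMpos : 0 < M := hpos M hMS
  have hvh : IsHarmonic d μ μ0 v := hh.sub ((hh.translate u).const_mul _)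
  have hkh : IsHarmonic d μ μ0 fun z => M * H z - v z := (hH.const_mul M).sub hvh
  have hk0 : ∀ z, 0 ≤ M * H z - v z := fun z => sub_nonneg.2 (hMS z)
  obtain ⟨N, hN⟩ := exists_nat_gt (2 / M)
  rw [div_lt_iff₀ hMpos] at hN
  set B := ∑ j ∈ Finset.range N, (r⁻¹ * C) ^ j with hB
  have hB0 : 0 ≤ B := Finset.sum_nonneg fun j _ => by positivity
  set ε := (B + 1)⁻¹ with hε
  have hεpos : 0 < ε := inv_pos.2 (by linarith)
  have hεB : ε * B < 1 := by
    rw [hε, inv_mul_lt_iff₀ (by linarith)]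
    linarith
  have hnot : M - ε ∉ S := fun hmem => by
    have := csInf_le hbdd hmem
    linarith
  obtain ⟨z, hz⟩ : ∃ z, (M - ε) * H z < v z := by
    by_contra hno
    push Not at hno
    exact hnot hno
  have hkz : M * H z - v z < ε * H z := by linarith
  have hHz : 0 < H z := by
    by_contra h0
    have : H z = 0 := le_antisymm (not_lt.1 h0) (hH0 z)
    rw [this, mul_zero ε] at hkz
    have h1 := hk0 z
    rw [this] at h1
    linarith
  let P : ℕ → St d := fun j => (z.1 + j • u, z.2)
  have hP0 : P 0 = z := by simp [P]
  have hPs : ∀ j, P (j + 1) = ((P j).1 + u, (P j).2) := by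
    intro j
    exact Prod.ext (by simp only [P]; rw [succ_nsmul, ← add_assoc]) rfl
  have hHP : ∀ j, H (P j) = r ^ j * H z := by
    intro j
    induction j with
    | zero => simp [hP0]
    | succ j ih => rw [hPs, hHr, ih]; ring
  have hkP : ∀ j, M * H (P j) - v (P j) ≤ C ^ j * (ε * H z) := by
    intro j
    induction j with
    | zero => simpa [hP0] using hkz.le
    | succ j ih =>
      calc M * H (P (j + 1)) - v (P (j + 1)) ≤ C * (M * H (P j) - v (P j)) := by
            rw [hPs]
            exact hharnack _ hkh hk0 (P j)
        _ ≤ C * (C ^ j * (ε * H z)) := by gcongr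
        _ = _ := by ring
  have htel : ∀ n, ∑ j ∈ Finset.range n, r⁻¹ ^ j * v (P j) = h z - r⁻¹ ^ n * h (P n) := by
    intro n
    induction n with
    | zero => simp [hP0]
    | succ n ih =>
      rw [Finset.sum_range_succ, ih, hPs]
      simp only [hv]
      ring
  have hlow : ∀ j, (M - ε * (r⁻¹ * C) ^ j) * H z ≤ r⁻¹ ^ j * v (P j) := by
    intro j
    have h1 := mul_le_mul_of_nonneg_left (hkP j) (pow_nonneg hr'.le j)
    have h2 : r⁻¹ ^ j * r ^ j = 1 := by rw [← mul_pow, inv_mul_cancel₀ hr.ne', one_pow]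
    have h3 : r⁻¹ ^ j * (M * H (P j) - v (P j)) = M * H z - r⁻¹ ^ j * v (P j) := by
      rw [hHP]
      linear_combination M * H z * h2
    rw [h3] at h1
    rw [mul_pow]
    linarith
  have hfin : (N * M - ε * B) * H z ≤ H z := by
    calc (N * M - ε * B) * H z
        = ∑ j ∈ Finset.range N, (M - ε * (r⁻¹ * C) ^ j) * H z := by
          rw [← Finset.sum_mul, Finset.sum_sub_distrib, ← Finset.mul_sum]
          simp [hB]
      _ ≤ ∑ j ∈ Finset.range N, r⁻¹ ^ j * v (P j) := Finset.sum_le_sum fun j _ => hlow j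
      _ = h z - r⁻¹ ^ N * h (P N) := htel N
      _ ≤ h z := sub_le_self _ (mul_nonneg (pow_nonneg hr'.le _) (hh0 _))
      _ ≤ H z := hle z
  nlinarith

/-- `h` is multiplied by `e^{α·u}` under translations by `u` along the boundary. -/
def IsCovariant (d : ℕ) (α : Fin (d - 1) → ℝ) (h : St d → ℝ) : Prop :=
  ∀ (x : Fin (d - 1) → ℤ) (y : ℕ),
    h (x, y) = Real.exp (∑ i, α i * (x i : ℝ)) * h (fun _ => 0, y)

theorem IsCovariant.translate {α : Fin (d - 1) → ℝ} {h : St d → ℝ} (hh : IsCovariant d α h)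
    (u : Fin (d - 1) → ℤ) (z : St d) :
    h (z.1 + u, z.2) = Real.exp (∑ i, α i * (u i : ℝ)) * h z := by
  rw [hh, show h z = h (z.1, z.2) from rfl, hh z.1, ← mul_assoc, ← Real.exp_add,
    ← Finset.sum_add_distrib]
  congr 2
  refine Finset.sum_congr rfl fun i _ => ?_
  simp only [Pi.add_apply, Int.cast_add]
  ring

theorem isCovariant_of_le (hμ : ∀ z, 0 ≤ μ z) (hμ0 : ∀ z, 0 ≤ μ0 z) (hH0 : H0 d μ μ0)
    (hH1 : H1 d μ μ0) (hH2 : H2 d μ) {α : Fin (d - 1) → ℝ} {H h : St d → ℝ}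
    (hH : IsHarmonic d μ μ0 H) (hHnn : ∀ z, 0 ≤ H z) (hHα : IsCovariant d α H)
    (hh : IsHarmonic d μ μ0 h) (hh0 : ∀ z, 0 ≤ h z) (hle : ∀ z, h z ≤ H z) :
    IsCovariant d α h := by
  have key : ∀ (u : Fin (d - 1) → ℤ) (z : St d),
      Real.exp (∑ i, α i * (u i : ℝ)) * h z ≤ h (z.1 + u, z.2) := by
    intro u z
    obtain ⟨C, hC, hharnack⟩ := exists_harnack hμ hμ0 hH0 hH1 hH2 u
    have := le_inv_mul_translate hC hharnack (Real.exp_pos (∑ i, α i * (u i : ℝ))) hH hHnn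
      (hHα.translate u) hh hh0 hle z
    rwa [← div_eq_inv_mul, le_div_iff₀' (Real.exp_pos _)] at this
  intro x y
  refine le_antisymm ?_ ?_
  · have := key (-x) (x, y)
    simp only [Pi.neg_apply, Int.cast_neg, mul_neg, Finset.sum_neg_distrib, Real.exp_neg,
      add_neg_cancel] at this
    rwa [← div_eq_inv_mul, div_le_iff₀' (Real.exp_pos _)] at this
  · have := key x (fun _ => 0, y)
    rwa [show ((fun _ => 0 : Fin (d - 1) → ℤ), y).1 + x = x from zero_add x] at this

end Harmonic

section Characterization

variable {d : ℕ} {μ μ0 : Zd d → ℝ}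

/-- Weights of the jumps `j - 1` of the last coordinate under the tilted law `μ(z) e^{a·z}`. -/
noncomputable def tiltedWeight (d : ℕ) (μ : Zd d → ℝ) (a : Rd d) (j : ℕ) : ℝ :=
  ∑' x : Fin (d - 1) → ℤ, μ (x, (j : ℤ) - 1) * Real.exp (dotZ d a (x, (j : ℤ) - 1))

theorem hasSum_fiber {F : Zd d → ℝ} {s : ℝ} (hF : HasSum F s) (h : ∀ z : Zd d, z.2 < -1 → F z = 0) :
    HasSum (fun j : ℕ => ∑' x, F (x, (j : ℤ) - 1)) s := by
  have hsw : HasSum (fun p : ℤ × (Fin (d - 1) → ℤ) => F (p.2, p.1)) s :=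
    (Equiv.prodComm ℤ (Fin (d - 1) → ℤ)).hasSum_iff.2 hF
  have h1 : HasSum (fun y : ℤ => ∑' x, F (x, y)) s :=
    hsw.prod_fiberwise fun y => (hsw.summable.prod_factor y).hasSum
  have hinj : Function.Injective fun j : ℕ => (j : ℤ) - 1 := fun i j hij => by
    simpa using hij
  refine (hinj.hasSum_iff fun y hy => ?_).2 h1
  have hy' : y < -1 := by
    by_contra hle
    exact hy ⟨(y + 1).toNat, by simp only; omega⟩
  exact (tsum_congr fun x => h (x, y) hy').trans tsum_zero

theorem hasSum_tiltedWeight_mul (hH0 : H0 d μ μ0) (a : Rd d) {ψ : ℕ → ℝ} {s : ℝ}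
    (h : HasSum (fun z : Zd d => μ z * Real.exp (dotZ d a z) * ψ (z.2 + 1).toNat) s) :
    HasSum (fun j => tiltedWeight d μ a j * ψ j) s := by
  refine hasSum_of_eq (hasSum_fiber h fun z hz => by rw [hH0.1 z hz, zero_mul, zero_mul])
    (fun j => ?_) rfl
  simp [tiltedWeight, tsum_mul_right]

theorem hasSum_tiltedWeight_mul_pow (hH0 : H0 d μ μ0) (hH4 : H4 d μ μ0) (a : Rd d) {κ : ℝ}
    (hκ : 0 < κ) :
    HasSum (fun j => tiltedWeight d μ a j * κ ^ j) (κ * jgf d μ (a.1, a.2 + Real.log κ)) := by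
  refine hasSum_tiltedWeight_mul hH0 a (hasSum_of_eq
    ((hasSum_jgf (fun a => (hH4 a).1) (a.1, a.2 + Real.log κ)).mul_left κ) (fun z => ?_) rfl)
  rcases lt_or_ge z.2 (-1) with hz | hz
  · simp [hH0.1 z hz]
  · have e : κ ^ (z.2 + 1).toNat = κ * Real.exp (Real.log κ * z.2) := by
      conv_lhs => rw [← Real.exp_log hκ]
      conv_rhs => rw [← Real.exp_log hκ, Real.log_exp]
      rw [← Real.exp_nat_mul, ← Real.exp_add]
      have : (((z.2 + 1).toNat : ℕ) : ℝ) = z.2 + 1 := by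
        have : (((z.2 + 1).toNat : ℕ) : ℤ) = z.2 + 1 := Int.toNat_of_nonneg (by omega)
        exact_mod_cast this
      rw [this]
      congr 1
      ring
    rw [e, dotZ_eq_add_of_fst_eq (a := a) (b := (a.1, a.2 + Real.log κ)) rfl, Real.exp_add]
    simp only [add_sub_cancel_left]
    ring

theorem hasSum_tiltedWeight_mul_nat (hμ : ∀ z, 0 ≤ μ z) (hH0 : H0 d μ μ0) (hH4 : H4 d μ μ0)
    (a : Rd d) : HasSum (fun j => tiltedWeight d μ a j * (j : ℝ)) (jgfDβ d μ a + jgf d μ a) := by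
  refine hasSum_tiltedWeight_mul hH0 a (hasSum_of_eq
    ((hasSum_jgfDβ hμ (fun a => (hH4 a).1) a).add (hasSum_jgf (fun a => (hH4 a).1) a))
    (fun z => ?_) rfl)
  rcases lt_or_ge z.2 (-1) with hz | hz
  · simp [hH0.1 z hz]
  · have : (((z.2 + 1).toNat : ℕ) : ℝ) = z.2 + 1 := by
      have : (((z.2 + 1).toNat : ℕ) : ℤ) = z.2 + 1 := Int.toNat_of_nonneg (by omega)
      exact_mod_cast this
    rw [this]
    ring

theorem tiltedWeight_nonneg (hμ : ∀ z, 0 ≤ μ z) (a : Rd d) (j : ℕ) : 0 ≤ tiltedWeight d μ a j :=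
  tsum_nonneg fun _ => mul_nonneg (hμ _) (Real.exp_pos _).le

theorem tiltedWeight_pos (hμ : ∀ z, 0 ≤ μ z) (hH4 : H4 d μ μ0) (a : Rd d) {z : Zd d}
    (hz : 0 < μ z) (hz1 : -1 ≤ z.2) : 0 < tiltedWeight d μ a (z.2 + 1).toNat := by
  have e : (((z.2 + 1).toNat : ℕ) : ℤ) - 1 = z.2 := by omega
  unfold tiltedWeight
  rw [e]
  have hs : Summable fun p : ℤ × (Fin (d - 1) → ℤ) =>
      μ (p.2, p.1) * Real.exp (dotZ d a (p.2, p.1)) :=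
    (Equiv.prodComm ℤ (Fin (d - 1) → ℤ)).summable_iff.2 (hH4 a).1
  exact (hs.prod_factor z.2).tsum_pos (fun x => mul_nonneg (hμ _) (Real.exp_pos _).le) z.1
    (mul_pos hz (Real.exp_pos _))

theorem IsCovariant.eq_exp_mul {a : Rd d} {h : St d → ℝ} (hh : IsCovariant d a.1 h) (z : St d) :
    h z = Real.exp (dotZ d a (toZ d z)) *
      (h (fun _ => 0, z.2) * Real.exp (-(a.2 * (z.2 : ℝ)))) := by
  have e := hh z.1 z.2
  rw [show (z.1, z.2) = z from rfl] at e
  rw [e, dotZ, Real.exp_add, Real.exp_neg]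
  simp only [toZ, Int.cast_natCast]
  field_simp

theorem IsCovariant.isHalfLineHarmonic (hH0 : H0 d μ μ0) {a : Rd d} {h : St d → ℝ}
    (hα : IsCovariant d a.1 h) (hh : IsHarmonic d μ μ0 h) :
    IsHalfLineHarmonic (tiltedWeight d μ a)
      fun y => h (fun _ => 0, y) * Real.exp (-(a.2 * (y : ℝ))) := by
  intro y
  set f : ℕ → ℝ := fun y => h (fun _ => 0, y) * Real.exp (-(a.2 * (y : ℝ))) with hf
  set z : St d := (fun _ => 0, y + 1) with hz
  have hE : Real.exp (dotZ d a (toZ d z)) ≠ 0 := (Real.exp_pos _).ne'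
  refine hasSum_tiltedWeight_mul (ψ := fun j => f (y + j)) hH0 a ?_
  rw [← hasSum_comp_toZ_sub z fun w hw => by
    rw [hH0.1 w (by simp only [hz] at hw; push_cast at hw; omega), zero_mul, zero_mul]]
  refine hasSum_of_eq ((hh z).mul_left (Real.exp (dotZ d a (toZ d z)))⁻¹) (fun z' => ?_) ?_
  · rw [stepR, if_neg (by simp [hz])]
    rcases lt_or_ge (toZ d z' - toZ d z).2 (-1) with hlt | hge
    · simp [hH0.1 _ hlt]
    · have e2 : (toZ d z' - toZ d z).2 = (z'.2 : ℤ) - (y + 1) := by simp [toZ, hz]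
      have e3 : y + ((toZ d z' - toZ d z).2 + 1).toNat = z'.2 := by omega
      have e : dotZ d a (toZ d z') = dotZ d a (toZ d z' - toZ d z) + dotZ d a (toZ d z) := by
        rw [← dotZ_add, sub_add_cancel]
      rw [e3, hα.eq_exp_mul z', e, Real.exp_add]
      simp only [hf]
      field_simp
  · rw [hα.eq_exp_mul z]
    simp only [hf, hz]
    field_simp

/-- The linear combinations of the two solutions of exponential type of the equations in the
interior. -/
noncomputable def expComb (d : ℕ) (a b : Rd d) (A B : ℝ) (z : St d) : ℝ :=
  A * Real.exp (dotZ d a (toZ d z)) + B * (if a = b then (z.2 : ℝ) * Real.exp (dotZ d a (toZ d z))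
    else Real.exp (dotZ d b (toZ d z)))

/-- The harmonic functions of exponential type along the boundary, before the equation on the
boundary is imposed. -/
theorem IsCovariant.exists_eq (hμ : ∀ z, 0 ≤ μ z) (hH0 : H0 d μ μ0)
    (hH1 : H1 d μ μ0) (hH2 : H2 d μ) (hH4 : H4 d μ μ0) {a b : Rd d} (ha : a ∈ bdPlus d μ)
    (hb : b ∈ bdMinus d μ) (hab : b.1 = a.1) {h : St d → ℝ} (hα : IsCovariant d a.1 h)
    (hh : IsHarmonic d μ μ0 h) (hh0 : ∀ z, 0 ≤ h z) :
    ∃ A B : ℝ, h = expComb d a b A B := by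
  have hs := fun a => (hH4 a).1
  obtain ⟨w, hw1, hw⟩ := exists_jump_down hH0 hH1
  obtain ⟨v, hv1, hv⟩ := exists_jump_up hH2
  have hne : ∃ z : Zd d, z.2 ≠ 0 ∧ 0 < μ z := ⟨w, by omega, hw⟩
  set q := Real.exp (b.2 - a.2) with hq
  have hqpos : 0 < q := Real.exp_pos _
  have hqa : (a.1, a.2 + Real.log q) = b := by
    rw [hq, Real.log_exp, ← hab, add_sub_cancel]
  obtain ⟨G, hG⟩ := IsHalfLineHarmonic.exists_recursion (tiltedWeight_nonneg hμ a)
    (by simpa [hw1] using tiltedWeight_pos hμ hH4 a hw (by omega)) (J := (v.2 + 1).toNat)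
    (by omega) (tiltedWeight_pos hμ hH4 a hv (by omega)) hqpos
    (by simpa [ha.1] using hasSum_tiltedWeight_mul_pow hH0 hH4 a one_pos)
    (by simpa [hqa, hb.1] using hasSum_tiltedWeight_mul_pow hH0 hH4 a hqpos)
    (fun hq1 => by
      have hba : b = a := Prod.ext hab (by
        rw [hq, Real.exp_eq_one_iff] at hq1
        linarith)
      have hD : jgfDβ d μ a = 0 := le_antisymm (hba ▸ hb.2) ha.2
      simpa [hD, ha.1] using hasSum_tiltedWeight_mul_nat hμ hH0 hH4 a)
    (fun κ s hκ hκq hsum => by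
      have hlog : a.2 + Real.log κ < b.2 := by
        have := Real.log_lt_log hκ hκq
        rw [hq, Real.log_exp] at this
        linarith
      rw [hsum.unique (hasSum_tiltedWeight_mul_pow hH0 hH4 a hκ)]
      have h1 := jgf_tangent_lt hμ hs hne (a := b) (b := (a.1, a.2 + Real.log κ)) hab.symm hlog.ne
      rw [hb.1] at h1
      have h2 : 0 ≤ jgfDβ d μ b * (a.2 + Real.log κ - b.2) :=
        mul_nonneg_of_nonpos_of_nonpos hb.2 (by linarith)
      nlinarith)
    (fun y => mul_nonneg (hh0 _) (Real.exp_pos _).le) (hα.isHalfLineHarmonic hH0 hh)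
  set f : ℕ → ℝ := fun y => h (fun _ => 0, y) * Real.exp (-(a.2 * (y : ℝ))) with hf
  have hG : ∀ y, f (y + 1) = q * f y + G := hG
  by_cases hba : a = b
  · have hq1 : q = 1 := by rw [hq, hba, sub_self, Real.exp_zero]
    have hfy : ∀ y : ℕ, f y = f 0 + G * y := by
      intro y
      induction y with
      | zero => simp
      | succ y ih => rw [hG y, hq1, one_mul]; rw [ih]; push_cast; ring
    refine ⟨f 0, G, funext fun z => ?_⟩
    rw [expComb, if_pos hba, hα.eq_exp_mul z]
    change _ * f z.2 = _
    rw [hfy]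
    ring
  · have hq1 : 1 - q ≠ 0 := by
      intro h0
      refine hba (Prod.ext hab.symm ?_)
      have : q = 1 := by linarith
      rw [hq, Real.exp_eq_one_iff] at this
      linarith
    have hfy : ∀ y : ℕ, f y = G / (1 - q) + (f 0 - G / (1 - q)) * q ^ y := by
      intro y
      induction y with
      | zero => simp
      | succ y ih =>
        rw [hG y]
        rw [ih, pow_succ]
        field_simp
        ring
    refine ⟨G / (1 - q), f 0 - G / (1 - q), funext fun z => ?_⟩
    have e : Real.exp (dotZ d b (toZ d z)) = Real.exp (dotZ d a (toZ d z)) * q ^ z.2 := by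
      rw [dotZ_eq_add_of_fst_eq hab, Real.exp_add, hq, ← Real.exp_nat_mul]
      simp only [toZ, Int.cast_natCast]
      rw [mul_comm (z.2 : ℝ)]
    rw [expComb, if_neg hba, hα.eq_exp_mul z, e]
    change _ * f z.2 = _
    rw [hfy]
    ring


theorem isCovariant_expComb {a b : Rd d} (hab : b.1 = a.1) (A B : ℝ) :
    IsCovariant d a.1 (expComb d a b A B) := by
  have key : ∀ c : Rd d, c.1 = a.1 → ∀ (x : Fin (d - 1) → ℤ) (y : ℕ),
      Real.exp (dotZ d c (toZ d (x, y))) = Real.exp (∑ i, a.1 i * (x i : ℝ)) *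
        Real.exp (dotZ d c (toZ d (fun _ => 0, y))) := by
    intro c hc x y
    rw [← Real.exp_add]
    simp [dotZ, toZ, hc]
  intro x y
  simp only [expComb]
  rw [key a rfl, key b hab]
  split_ifs <;> ring

/-- The boundary equation for `expComb d a b A B`. -/
noncomputable def boundaryEq (d : ℕ) (μ0 : Zd d → ℝ) (a b : Rd d) (A B : ℝ) : ℝ :=
  A * (jgf d μ0 a - 1) + B * (if a = b then jgfDβ d μ0 a else jgf d μ0 b - 1)

theorem hasSum_stepR_mul_expComb (hμ : ∀ z, 0 ≤ μ z) (hμ0 : ∀ z, 0 ≤ μ0 z)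
    (hH0 : H0 d μ μ0) (hH4 : H4 d μ μ0) (a b : Rd d) (A B : ℝ) (z : St d) :
    HasSum (fun z' => stepR d μ μ0 z z' * expComb d a b A B z')
      (A * (jgf d (jump d μ μ0 z) a * Real.exp (dotZ d a (toZ d z))) + B * (if a = b then
        (z.2 * jgf d (jump d μ μ0 z) a + jgfDβ d (jump d μ μ0 z) a) *
          Real.exp (dotZ d a (toZ d z))
        else jgf d (jump d μ μ0 z) b * Real.exp (dotZ d b (toZ d z)))) := by
  have h1 := hasSum_stepR_mul_exp hH0 hH4 a z
  unfold expComb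
  split_ifs with h
  · exact hasSum_of_eq ((h1.mul_left A).add
      ((hasSum_stepR_mul_snd_mul_exp hμ hμ0 hH0 hH4 a z).mul_left B)) (fun _ => by ring) rfl
  · exact hasSum_of_eq ((h1.mul_left A).add
      ((hasSum_stepR_mul_exp hH0 hH4 b z).mul_left B)) (fun _ => by ring) rfl

theorem isHarmonic_expComb_iff (hμ : ∀ z, 0 ≤ μ z) (hμ0 : ∀ z, 0 ≤ μ0 z)
    (hH0 : H0 d μ μ0) (hH4 : H4 d μ μ0) {a b : Rd d} (ha : a ∈ bdPlus d μ)
    (hb : b ∈ bdMinus d μ) (hab : b.1 = a.1) (A B : ℝ) :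
    IsHarmonic d μ μ0 (expComb d a b A B) ↔ boundaryEq d μ0 a b A B = 0 := by
  constructor
  · intro h
    have e := (h (fun _ => 0, 0)).unique
      (hasSum_stepR_mul_expComb hμ hμ0 hH0 hH4 a b A B (fun _ => 0, 0))
    by_cases hba : a = b <;> simp [expComb, boundaryEq, jump, dotZ, toZ, hba] at e ⊢ <;> linarith
  · intro h z
    refine hasSum_of_eq (hasSum_stepR_mul_expComb hμ hμ0 hH0 hH4 a b A B z) (fun _ => rfl) ?_
    rcases eq_or_ne z.2 0 with hz | hz
    · have hexp : Real.exp (dotZ d b (toZ d z)) = Real.exp (dotZ d a (toZ d z)) := by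
        rw [dotZ_eq_add_of_fst_eq hab]
        simp [toZ, hz]
      simp only [expComb, boundaryEq, jump, hz, if_true, hexp] at h ⊢
      split_ifs at h ⊢
      · rw [Nat.cast_zero]
        linear_combination (-Real.exp (dotZ d a (toZ d z))) * h
      · linear_combination (-Real.exp (dotZ d a (toZ d z))) * h
    · simp only [expComb, jump, hz, if_false, ha.1, hb.1]
      split_ifs with hba
      · rw [le_antisymm (hba ▸ hb.2) ha.2]
        ring
      · ring

theorem jgf_zero_lt (hμ0 : ∀ z, 0 ≤ μ0 z) (hH0 : H0 d μ μ0) (hH1 : H1 d μ μ0) (hH4 : H4 d μ μ0)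
    {a b : Rd d} (hab : b.1 = a.1) (hle : b.2 ≤ a.2) (hne : a ≠ b) :
    jgf d μ0 b < jgf d μ0 a := by
  have hlt : b.2 < a.2 := lt_of_le_of_ne hle fun h => hne (Prod.ext hab.symm h.symm)
  have hs := fun a => (hH4 a).2
  have := jgf_tangent_le hμ0 hs hab.symm
  nlinarith [jgfDβ_pos hμ0 hs hH0.2 (exists_boundary_jump_up hH1) b]

theorem exists_hfun_eq_expComb (a b : Rd d) : ∃ A B, hfun d μ μ0 a b = expComb d a b A B ∧
    (jgf d μ0 b = 1 → a = b → A = 1 ∧ B = 0) ∧ (jgf d μ0 b = 1 → a ≠ b → A = 0 ∧ B = 1) ∧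
    (jgf d μ0 b ≠ 1 → a = b → A = jgfDβ d μ0 a / (1 - jgf d μ0 a) ∧ B = 1) ∧
    (jgf d μ0 b ≠ 1 → a ≠ b → A = 1 ∧ B = -((1 - jgf d μ0 a) / (1 - jgf d μ0 b))) := by
  by_cases h1 : jgf d μ0 b = 1 <;> by_cases h2 : a = b
  · refine ⟨1, 0, funext fun z => ?_, by simp_all⟩
    simp [hfun, expComb, h1, h2]
  · refine ⟨0, 1, funext fun z => ?_, by simp_all⟩
    simp [hfun, expComb, h1, h2]
  · refine ⟨jgfDβ d μ0 a / (1 - jgf d μ0 a), 1, funext fun z => ?_, by simp_all⟩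
    simp [hfun, expComb, h1, h2, add_comm]
  · refine ⟨1, -((1 - jgf d μ0 a) / (1 - jgf d μ0 b)), funext fun z => ?_, by simp_all⟩
    simp [hfun, expComb, h1, h2, sub_eq_add_neg]

theorem isCovariant_hfun {a b : Rd d} (hab : b.1 = a.1) :
    IsCovariant d a.1 (hfun d μ μ0 a b) := by
  obtain ⟨A, B, h, -⟩ := exists_hfun_eq_expComb (μ := μ) (μ0 := μ0) a b
  exact h ▸ isCovariant_expComb hab A B

theorem isHarmonic_hfun (hμ : ∀ z, 0 ≤ μ z) (hμ0 : ∀ z, 0 ≤ μ0 z)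
    (hH0 : H0 d μ μ0) (hH4 : H4 d μ μ0) {a b : Rd d} (ha : a ∈ bdPlus d μ)
    (hb : b ∈ bdMinus d μ) (hab : b.1 = a.1) : IsHarmonic d μ μ0 (hfun d μ μ0 a b) := by
  obtain ⟨A, B, h, h1, h2, h3, h4⟩ := exists_hfun_eq_expComb (μ := μ) (μ0 := μ0) a b
  rw [h, isHarmonic_expComb_iff hμ hμ0 hH0 hH4 ha hb hab, boundaryEq]
  by_cases hF : jgf d μ0 b = 1 <;> by_cases hba : a = b
  · rw [(h1 hF hba).1, (h1 hF hba).2, hba, hF]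
    ring
  · rw [(h2 hF hba).1, (h2 hF hba).2, if_neg hba, hF]
    ring
  · have : 1 - jgf d μ0 a ≠ 0 := fun h => hF (by rw [← hba]; linarith)
    rw [(h3 hF hba).1, (h3 hF hba).2, if_pos hba]
    field_simp
    ring
  · have : 1 - jgf d μ0 b ≠ 0 := fun h => hF (by linarith)
    rw [(h4 hF hba).1, (h4 hF hba).2, if_neg hba]
    field_simp
    ring

theorem hfun_nonneg_and_pos (hμ0 : ∀ z, 0 ≤ μ0 z) (hH0 : H0 d μ μ0)
    (hH1 : H1 d μ μ0) (hH4 : H4 d μ μ0) {a b : Rd d} (hab : b.1 = a.1) (hle : b.2 ≤ a.2)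
    (hF : jgf d μ0 b ≤ 1) :
    (∀ z, 0 ≤ hfun d μ μ0 a b z) ∧ 0 < hfun d μ μ0 a b (fun _ => 0, 0) := by
  unfold hfun
  split_ifs with h1 h2
  · exact ⟨fun z => (Real.exp_pos _).le, Real.exp_pos _⟩
  · have hlt : 0 < 1 - jgf d μ0 a := sub_pos.2 (h2 ▸ lt_of_le_of_ne hF h1)
    have hD := jgfDβ_pos hμ0 (fun a => (hH4 a).2) hH0.2 (exists_boundary_jump_up hH1) a
    refine ⟨fun z => by positivity, ?_⟩
    simp only [Nat.cast_zero, zero_mul, zero_add]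
    positivity
  · have hlt : 0 < 1 - jgf d μ0 b := sub_pos.2 (lt_of_le_of_ne hF h1)
    have hC : (1 - jgf d μ0 a) / (1 - jgf d μ0 b) < 1 := by
      rw [div_lt_one hlt]
      linarith [jgf_zero_lt hμ0 hH0 hH1 hH4 hab hle h2]
    refine ⟨fun z => ?_, ?_⟩
    · have hexp : Real.exp (dotZ d b (toZ d z)) ≤ Real.exp (dotZ d a (toZ d z)) := by
        rw [dotZ_eq_add_of_fst_eq hab, Real.exp_le_exp]
        have : (0 : ℝ) ≤ z.2 := Nat.cast_nonneg _
        simp only [toZ, Int.cast_natCast]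
        nlinarith
      nlinarith [Real.exp_pos (dotZ d b (toZ d z))]
    · simpa [dotZ, toZ] using hC

theorem IsCovariant.eq_const_mul_hfun (hμ : ∀ z, 0 ≤ μ z) (hμ0 : ∀ z, 0 ≤ μ0 z)
    (hH0 : H0 d μ μ0) (hH1 : H1 d μ μ0) (hH2 : H2 d μ) (hH4 : H4 d μ μ0) {a b : Rd d}
    (ha : a ∈ bdPlus d μ) (hb : b ∈ bdMinus d μ) (hab : b.1 = a.1) (hle : b.2 ≤ a.2)
    (hF1 : jgf d μ0 b ≤ 1) {h : St d → ℝ} (hα : IsCovariant d a.1 h)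
    (hh : IsHarmonic d μ μ0 h) (hh0 : ∀ z, 0 ≤ h z) (hne : h ≠ 0) :
    ∃ c : ℝ, 0 < c ∧ h = fun z => c * hfun d μ μ0 a b z := by
  suffices ∃ c : ℝ, h = fun z => c * hfun d μ μ0 a b z by
    obtain ⟨c, hc⟩ := this
    refine ⟨c, lt_of_le_of_ne ?_ ?_, hc⟩
    · have h0 := hh0 (fun _ => 0, 0)
      rw [hc] at h0
      exact nonneg_of_mul_nonneg_left h0 (hfun_nonneg_and_pos hμ0 hH0 hH1 hH4 hab hle hF1).2
    · rintro rfl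
      exact hne (hc.trans (funext fun z => zero_mul _))
  obtain ⟨A, B, rfl⟩ := hα.exists_eq hμ hH0 hH1 hH2 hH4 ha hb hab hh hh0
  have hE := (isHarmonic_expComb_iff hμ hμ0 hH0 hH4 ha hb hab A B).1 hh
  obtain ⟨A', B', hAB, h1, h2, h3, h4⟩ := exists_hfun_eq_expComb (μ := μ) (μ0 := μ0) a b
  rw [hAB]
  suffices ∃ c : ℝ, A = c * A' ∧ B = c * B' by
    obtain ⟨c, rfl, rfl⟩ := this
    exact ⟨c, funext fun z => by simp only [expComb]; ring⟩
  rw [boundaryEq] at hE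
  by_cases hF : jgf d μ0 b = 1 <;> by_cases hba : a = b
  · have hD := jgfDβ_pos hμ0 (fun a => (hH4 a).2) hH0.2 (exists_boundary_jump_up hH1) a
    rw [if_pos hba, show jgf d μ0 a = 1 from hba ▸ hF] at hE
    have hB : B = 0 := by simpa [hD.ne'] using hE
    exact ⟨A, by rw [(h1 hF hba).1, mul_one], by rw [(h1 hF hba).2, hB, mul_zero]⟩
  · have hlt := jgf_zero_lt hμ0 hH0 hH1 hH4 hab hle hba
    rw [if_neg hba, hF, sub_self, mul_zero, add_zero] at hE
    have hA : A = 0 := (mul_eq_zero.1 hE).resolve_right (by linarith)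
    exact ⟨B, by rw [(h2 hF hba).1, hA, mul_zero], by rw [(h2 hF hba).2, mul_one]⟩
  · have : 1 - jgf d μ0 a ≠ 0 := fun h => hF (by rw [← hba]; linarith)
    rw [if_pos hba] at hE
    refine ⟨B, ?_, by rw [(h3 hF hba).2, mul_one]⟩
    rw [(h3 hF hba).1]
    field_simp
    linarith
  · have : 1 - jgf d μ0 b ≠ 0 := fun h => hF (by linarith)
    rw [if_neg hba] at hE
    refine ⟨A, by rw [(h4 hF hba).1, mul_one], ?_⟩
    rw [(h4 hF hba).2]
    field_simp
    linarith

end Characterization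

/-- for `a = (α,β) ∈ (Θ×ℝ)∩∂₊D`, the constant positive multiples of
`h_a` are exactly the minimal nonnegative harmonic functions `h` with
`h(x,y) = e^{α·x} h(0,y)`. -/
theorem minimal_harmonic_characterization
    (d : ℕ) (hd : 2 ≤ d) (μ μ0 : Zd d → ℝ)
    (hμ : IsProb d μ) (hμ0 : IsProb d μ0)
    (hH0 : H0 d μ μ0) (hH1 : H1 d μ μ0) (hH2 : H2 d μ)
    (hH3 : H3 d μ μ0) (hH4 : H4 d μ μ0)
    (a abar : Rd d) (ha : a.1 ∈ Theta d μ μ0 ∧ a ∈ bdPlus d μ)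
    (habar : abar ∈ bdMinus d μ ∧ abar.1 = a.1) :
    ∀ h : St d → ℝ,
      (IsMinimalHarmonic d μ μ0 h ∧
        ∀ (x : Fin (d-1) → ℤ) (y : ℕ),
          h (x, y) = Real.exp (∑ i, a.1 i * (x i : ℝ)) * h (fun _ => 0, y))
      ↔ ∃ c : ℝ, 0 < c ∧ h = fun z => c * hfun d μ μ0 a abar z := by
  obtain ⟨hμp, -⟩ := hμ
  obtain ⟨hμ0p, -⟩ := hμ0
  obtain ⟨hθ, hap⟩ := ha
  obtain ⟨hb, hab⟩ := habar
  have hne : ∃ z : Zd d, z.2 ≠ 0 ∧ 0 < μ z := by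
    obtain ⟨z, hz, hpos⟩ := exists_jump_up hH2
    exact ⟨z, by omega, hpos⟩
  have hle := snd_le_of_bdMinus_of_bdPlus hμp (fun a => (hH4 a).1) hne hap hb hab
  have hF := jgf_zero_le_one_of_mem_Theta hμp hμ0p hH4
    (jgfDβ_pos hμ0p (fun a => (hH4 a).2) hH0.2 (exists_boundary_jump_up hH1)) hne (hab ▸ hθ) hb
  obtain ⟨hnn, hpos⟩ := hfun_nonneg_and_pos hμ0p hH0 hH1 hH4 hab hle hF
  intro h
  constructor
  · rintro ⟨⟨hh, hh0, hh1, -⟩, hα⟩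
    exact IsCovariant.eq_const_mul_hfun hμp hμ0p hH0 hH1 hH2 hH4 hap hb hab hle hF hα hh hh0 hh1
  · rintro ⟨c, hc, rfl⟩
    have hH := (isHarmonic_hfun hμp hμ0p hH0 hH4 hap hb hab).const_mul c
    have hH0' : ∀ z, 0 ≤ c * hfun d μ μ0 a abar z := fun z => mul_nonneg hc.le (hnn z)
    have hα : IsCovariant d a.1 fun z => c * hfun d μ μ0 a abar z := fun x y => by
      simp only [isCovariant_hfun hab x y]
      ring
    refine ⟨⟨hH, hH0', fun h0 => (mul_pos hc hpos).ne' (congrFun h0 _), ?_⟩, hα⟩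
    intro h' hh hh0 hh1 hle'
    obtain ⟨c', hc', rfl⟩ := IsCovariant.eq_const_mul_hfun hμp hμ0p hH0 hH1 hH2 hH4 hap hb hab
      hle hF (isCovariant_of_le hμp hμ0p hH0 hH1 hH2 hH hH0' hα hh hh0 hle') hh hh0 hh1
    refine ⟨c' / c, div_pos hc' hc, funext fun z => ?_⟩
    field_simp

end ReflectedRW
end
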